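/- arXiv:2011.11884 — 3 statements merged into one kernel-verified Lean document; each statement's English description precedes it below -/
import Mathlib

section
/- For the SMG iterates with arbitrary permutations, under L-smoothness (b) and generalized bounded variance (c): (a) for t > 1, I_t ≤ L²·ξ_t²·[ β·(I_{t−1} + K_{t−1}) + (3/2)·(1−β)·(I_t + K_t) ], and I_1 ≤ (3/2)·L²·ξ_1²·(1−β)²·(I_1 + K_1); (b) for t > 2, J_t ≤ 3·L²·ξ_t²·[ β·(I_{t−2} + K_{t−2}) + (1−β)·(I_{t−1} + K_{t−1}) ], and J_2 ≤ 3·L²·ξ_2²·(I_1 + K_1); (c) if in addition L²·ξ_t² ≤ 2/5, then for t > 1, I_t + K_t ≤ β·(I_{t−1} + K_{t−1}) + ((5−3β)/2)·K_t, and I_1 + K_1 ≤ ((5−3β)/2)·K_1. -/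
open Finset

/-- Squared displacement of a sequence driven by steps `c • h k`. -/
lemma norm_sub_sq_le_of_step {E : Type*} [NormedAddCommGroup E] [InnerProductSpace ℝ E]
    {n : ℕ} {c : ℝ} {x h : ℕ → E} (hx : ∀ i < n, x (i + 1) = x i - c • h i)
    {i j : ℕ} (hij : i ≤ j) (hj : j ≤ n) :
    ‖x i - x j‖ ^ 2 ≤ c ^ 2 * ((j - i : ℝ) * ∑ k ∈ range n, ‖h k‖ ^ 2) := by
  have hsum : x i - x j = c • ∑ k ∈ Ico i j, h k := by
    induction j, hij using Nat.le_induction with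
    | base => simp
    | succ j hij ih =>
      rw [sum_Ico_succ_top hij, smul_add, ← ih (by omega), hx j (by omega)]
      abel
  have hcs : ‖∑ k ∈ Ico i j, h k‖ ^ 2 ≤ (j - i : ℝ) * ∑ k ∈ Ico i j, ‖h k‖ ^ 2 := by
    have hcard := sq_sum_le_card_mul_sum_sq (s := Ico i j) (f := fun k => ‖h k‖)
    rw [Nat.card_Ico, Nat.cast_sub hij] at hcard
    exact (pow_le_pow_left₀ (norm_nonneg _) (norm_sum_le _ _) 2).trans hcard
  have hsub : ∑ k ∈ Ico i j, ‖h k‖ ^ 2 ≤ ∑ k ∈ range n, ‖h k‖ ^ 2 := by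
    refine sum_le_sum_of_subset_of_nonneg (fun k hk => ?_) fun _ _ _ => sq_nonneg _
    rw [mem_Ico] at hk
    exact mem_range.2 (by omega)
  have hij' : (0 : ℝ) ≤ j - i := sub_nonneg.2 (by exact_mod_cast hij)
  rw [hsum, norm_smul, mul_pow, Real.norm_eq_abs, sq_abs]
  gcongr
  exact hcs.trans (mul_le_mul_of_nonneg_left hsub hij')

lemma sum_range_cast_le (n : ℕ) : ∑ i ∈ range n, (i : ℝ) ≤ (n : ℝ) ^ 2 / 2 := by
  induction n with
  | zero => simp
  | succ n ih =>
    rw [sum_range_succ]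
    push_cast
    nlinarith

/-- Total squared distance of the iterates from the first one. -/
lemma sum_norm_sub_first_sq_le {E : Type*} [NormedAddCommGroup E] [InnerProductSpace ℝ E]
    {n : ℕ} (hn : 1 ≤ n) {a : ℝ} {x h : ℕ → E}
    (hx : ∀ i < n, x (i + 1) = x i - (a / n) • h i) :
    ∑ i ∈ range n, ‖x 0 - x i‖ ^ 2 ≤ a ^ 2 / 2 * ∑ k ∈ range n, ‖h k‖ ^ 2 := by
  have hn' : (0 : ℝ) < n := by exact_mod_cast hn
  have hH : 0 ≤ ∑ k ∈ range n, ‖h k‖ ^ 2 := sum_nonneg fun _ _ => sq_nonneg _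
  calc ∑ i ∈ range n, ‖x 0 - x i‖ ^ 2
      ≤ ∑ i ∈ range n, (a / n) ^ 2 * ((i : ℝ) * ∑ k ∈ range n, ‖h k‖ ^ 2) :=
        sum_le_sum fun i hi => by
          simpa using norm_sub_sq_le_of_step hx (Nat.zero_le i) (mem_range.1 hi).le
    _ = (a / n) ^ 2 * ((∑ i ∈ range n, (i : ℝ)) * ∑ k ∈ range n, ‖h k‖ ^ 2) := by
        rw [← mul_sum, ← sum_mul]
    _ ≤ (a / n) ^ 2 * ((n : ℝ) ^ 2 / 2 * ∑ k ∈ range n, ‖h k‖ ^ 2) := by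
        gcongr
        exact sum_range_cast_le n
    _ = a ^ 2 / 2 * ∑ k ∈ range n, ‖h k‖ ^ 2 := by
        field_simp

/-- Total squared distance of the iterates from the last one. -/
lemma sum_norm_sub_last_sq_le {E : Type*} [NormedAddCommGroup E] [InnerProductSpace ℝ E]
    {n : ℕ} (hn : 1 ≤ n) {a : ℝ} {x h : ℕ → E}
    (hx : ∀ i < n, x (i + 1) = x i - (a / n) • h i) :
    ∑ i ∈ range n, ‖x n - x i‖ ^ 2 ≤ a ^ 2 * ∑ k ∈ range n, ‖h k‖ ^ 2 := by
  have hn' : (0 : ℝ) < n := by exact_mod_cast hn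
  have hH : 0 ≤ ∑ k ∈ range n, ‖h k‖ ^ 2 := sum_nonneg fun _ _ => sq_nonneg _
  calc ∑ i ∈ range n, ‖x n - x i‖ ^ 2
      ≤ ∑ i ∈ range n, (a / n) ^ 2 * ((n : ℝ) * ∑ k ∈ range n, ‖h k‖ ^ 2) :=
        sum_le_sum fun i hi => by
          rw [norm_sub_rev]
          refine (norm_sub_sq_le_of_step hx (mem_range.1 hi).le le_rfl).trans ?_
          gcongr
          exact sub_le_self _ (Nat.cast_nonneg i)
    _ = a ^ 2 * ∑ k ∈ range n, ‖h k‖ ^ 2 := by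
        rw [sum_const, card_range, nsmul_eq_mul]
        field_simp

lemma norm_convex_comb_sq_le {E : Type*} [NormedAddCommGroup E] [InnerProductSpace ℝ E]
    {β : ℝ} (hβ0 : 0 ≤ β) (hβ1 : β ≤ 1) (x y : E) :
    ‖β • x + (1 - β) • y‖ ^ 2 ≤ β * ‖x‖ ^ 2 + (1 - β) * ‖y‖ ^ 2 := by
  have h1 : ‖β • x + (1 - β) • y‖ ≤ β * ‖x‖ + (1 - β) * ‖y‖ := by
    refine (norm_add_le _ _).trans_eq ?_
    rw [norm_smul, norm_smul, Real.norm_of_nonneg hβ0, Real.norm_of_nonneg (sub_nonneg.2 hβ1)]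
  have h2 := pow_le_pow_left₀ (norm_nonneg _) h1 2
  nlinarith [mul_nonneg (mul_nonneg hβ0 (sub_nonneg.2 hβ1)) (sq_nonneg (‖x‖ - ‖y‖))]

/-- Bias-variance decomposition around the mean `c`. -/
lemma sum_norm_sq_eq_of_mean {E : Type*} [NormedAddCommGroup E] [InnerProductSpace ℝ E]
    {n : ℕ} {a : Fin n → E} {c : E} (hc : ∑ i, a i = (n : ℝ) • c) :
    ∑ i, ‖a i‖ ^ 2 = ∑ i, ‖a i - c‖ ^ 2 + n * ‖c‖ ^ 2 := by
  have h : ∑ i, ‖a i - c‖ ^ 2 = ∑ i, ‖a i‖ ^ 2 - 2 * inner ℝ (∑ i, a i) c + n * ‖c‖ ^ 2 := by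
    simp_rw [norm_sub_sq_real, sum_add_distrib, sum_sub_distrib, ← mul_sum, ← sum_inner]
    simp
  rw [hc, inner_smul_left, real_inner_self_eq_norm_sq] at h
  simp only [conj_trivial] at h
  linarith

lemma sum_gradient_eq_smul_gradient_mean {E : Type*} [NormedAddCommGroup E]
    [InnerProductSpace ℝ E] [CompleteSpace E] {n : ℕ} (hn : 1 ≤ n) {f : Fin n → E → ℝ}
    (hf : ∀ i, Differentiable ℝ (f i)) (x : E) :
    ∑ i, gradient (f i) x = (n : ℝ) • gradient (fun y => (1 / (n : ℝ)) * ∑ i, f i y) x := by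
  have hn' : (n : ℝ) ≠ 0 := by
    have : n ≠ 0 := by omega
    exact_mod_cast this
  have hd : fderiv ℝ (fun y => (1 / (n : ℝ)) * ∑ i, f i y) x
      = (1 / (n : ℝ)) • ∑ i, fderiv ℝ (f i) x := by
    rw [fderiv_const_mul (DifferentiableAt.fun_sum fun i _ => (hf i) x),
      fderiv_fun_sum fun i _ => (hf i) x]
  simp only [gradient, hd, map_smul, map_sum, smul_smul]
  rw [mul_one_div_cancel hn', one_smul]

/-- Total squared norm of the sampled gradients, in terms of their drift and the variance bound. -/
lemma sum_norm_sq_le_of_variance {E : Type*} [NormedAddCommGroup E] [InnerProductSpace ℝ E]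
    {n : ℕ} (hn : 1 ≤ n) {a b : Fin n → E} {c : E} {Θ σ : ℝ} (π : Equiv.Perm (Fin n))
    (hc : ∑ i, a i = (n : ℝ) • c)
    (hvar : (1 / (n : ℝ)) * ∑ i, ‖a i - c‖ ^ 2 ≤ Θ * ‖c‖ ^ 2 + σ ^ 2) :
    ∑ i, ‖b i‖ ^ 2 ≤ 2 * (∑ i, ‖a (π i) - b i‖ ^ 2
      + ((n : ℝ) * (Θ + 1) * ‖c‖ ^ 2 + n * σ ^ 2)) := by
  have hn' : (0 : ℝ) < n := by exact_mod_cast hn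
  have h1 : ∑ i, ‖b i‖ ^ 2 ≤ ∑ i, (2 * ‖a (π i) - b i‖ ^ 2 + 2 * ‖a (π i)‖ ^ 2) := by
    refine sum_le_sum fun i _ => ?_
    have h := norm_sub_le (a (π i)) (a (π i) - b i)
    rw [sub_sub_cancel] at h
    nlinarith [pow_le_pow_left₀ (norm_nonneg _) h 2,
      sq_nonneg (‖a (π i)‖ - ‖a (π i) - b i‖)]
  rw [sum_add_distrib, ← mul_sum, ← mul_sum, Equiv.sum_comp π fun i => ‖a i‖ ^ 2,
    sum_norm_sq_eq_of_mean hc] at h1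
  have h2 : ∑ i, ‖a i - c‖ ^ 2 ≤ n * (Θ * ‖c‖ ^ 2 + σ ^ 2) := by
    rw [one_div, inv_mul_le_iff₀ hn'] at hvar
    exact hvar
  linarith

theorem smg_lemma3
    (n d : ℕ) (hn : 1 ≤ n) (hd : 1 ≤ d)
    (f : Fin n → EuclideanSpace ℝ (Fin d) → ℝ)
    (hf : ∀ i, Differentiable ℝ (f i))
    (F : EuclideanSpace ℝ (Fin d) → ℝ)
    (hF : F = fun x => (1 / (n : ℝ)) * ∑ i, f i x)
    (L : ℝ) (hL : 0 < L)
    (hsmooth : ∀ i x y, ‖gradient (f i) x - gradient (f i) y‖ ≤ L * ‖x - y‖)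
    (Θ σ : ℝ) (hΘ : 0 ≤ Θ) (hσ : 0 ≤ σ)
    (hvar : ∀ x, (1 / (n : ℝ)) * ∑ i, ‖gradient (f i) x - gradient F x‖ ^ 2
        ≤ Θ * ‖gradient F x‖ ^ 2 + σ ^ 2)
    (T : ℕ) (hT : 1 ≤ T)
    (β : ℝ) (hβ0 : 0 ≤ β) (hβ1 : β < 1)
    (η : ℕ → ℝ) (hηpos : ∀ t, 1 ≤ t → t ≤ T → 0 < η t)
    (π : ℕ → Equiv.Perm (Fin n))
    (w m v g : ℕ → ℕ → EuclideanSpace ℝ (Fin d))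
    (wt mt : ℕ → EuclideanSpace ℝ (Fin d))
    (hmt0 : mt 0 = 0)
    (hw0 : ∀ t, 1 ≤ t → t ≤ T → w t 0 = wt (t - 1))
    (hm0 : ∀ t, 1 ≤ t → t ≤ T → m t 0 = mt (t - 1))
    (hv0 : ∀ t, 1 ≤ t → t ≤ T → v t 0 = 0)
    (hg : ∀ t, 1 ≤ t → t ≤ T → ∀ i, ∀ hi : i < n,
        g t i = gradient (f (π t ⟨i, hi⟩)) (w t i))
    (hm1 : ∀ t, 1 ≤ t → t ≤ T → ∀ i, i < n →
        m t (i + 1) = β • m t 0 + (1 - β) • g t i)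
    (hv1 : ∀ t, 1 ≤ t → t ≤ T → ∀ i, i < n →
        v t (i + 1) = v t i + ((n : ℝ))⁻¹ • g t i)
    (hw1 : ∀ t, 1 ≤ t → t ≤ T → ∀ i, i < n →
        w t (i + 1) = w t i - (η t / (n : ℝ)) • m t (i + 1))
    (hwt : ∀ t, 1 ≤ t → t ≤ T → wt t = w t n)
    (hmt : ∀ t, 1 ≤ t → t ≤ T → mt t = v t n)
    (ξ : ℕ → ℝ) (hξ1 : ξ 1 = η 1) (hξ : ∀ t, 2 ≤ t → ξ t = max (η t) (η (t - 1)))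
    (I K' : ℕ → ℝ)
    (hI : ∀ t, I t = ∑ i : Fin n, ‖gradient (f (π t i)) (w t 0) - g t (i : ℕ)‖ ^ 2)
    (hK' : ∀ t, K' t = (n : ℝ) * (Θ + 1) * ‖gradient F (w t 0)‖ ^ 2 + (n : ℝ) * σ ^ 2)
    (J : ℕ → ℝ)
    (hJ : ∀ t, 2 ≤ t →
        J t = ∑ i : Fin n, ‖gradient (f (π (t - 1) i)) (w t 0) - g (t - 1) (i : ℕ)‖ ^ 2)
    :
    (∀ t, 2 ≤ t → t ≤ T →
        I t ≤ L ^ 2 * ξ t ^ 2 *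
          (β * (I (t - 1) + K' (t - 1)) + 3 / 2 * (1 - β) * (I t + K' t))) ∧
    (I 1 ≤ 3 / 2 * L ^ 2 * ξ 1 ^ 2 * (1 - β) ^ 2 * (I 1 + K' 1)) ∧
    (∀ t, 3 ≤ t → t ≤ T →
        J t ≤ 3 * L ^ 2 * ξ t ^ 2 *
          (β * (I (t - 2) + K' (t - 2)) + (1 - β) * (I (t - 1) + K' (t - 1)))) ∧
    (2 ≤ T → J 2 ≤ 3 * L ^ 2 * ξ 2 ^ 2 * (I 1 + K' 1)) ∧
    (∀ t, 2 ≤ t → t ≤ T → L ^ 2 * ξ t ^ 2 ≤ 2 / 5 →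
        I t + K' t ≤ β * (I (t - 1) + K' (t - 1)) + (5 - 3 * β) / 2 * K' t) ∧
    (L ^ 2 * ξ 1 ^ 2 ≤ 2 / 5 → I 1 + K' 1 ≤ (5 - 3 * β) / 2 * K' 1) := by
  subst hF
  have hn' : (0 : ℝ) < n := by exact_mod_cast hn
  have hβ : 0 ≤ 1 - β := by linarith
  have hG : ∀ t, ∑ i ∈ range n, ‖g t i‖ ^ 2 ≤ 2 * (I t + K' t) := by
    intro t
    rw [sum_range, hI, hK']
    exact sum_norm_sq_le_of_variance (a := fun i => gradient (f i) (w t 0))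
      (b := fun i => g t i) hn (π t)
      (sum_gradient_eq_smul_gradient_mean hn hf (w t 0)) (hvar (w t 0))
  have hK0 : ∀ t, 0 ≤ K' t := by
    intro t
    rw [hK']
    positivity
  have hI0 : ∀ t, 0 ≤ I t := by
    intro t
    rw [hI]
    positivity
  have hdrift : ∀ t, 1 ≤ t → t ≤ T → ∀ y,
      ∑ i : Fin n, ‖gradient (f (π t i)) y - g t (i : ℕ)‖ ^ 2
        ≤ L ^ 2 * ∑ i ∈ range n, ‖y - w t i‖ ^ 2 := by
    intro t h1 hT y
    rw [sum_range, mul_sum]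
    refine sum_le_sum fun i _ => ?_
    rw [hg t h1 hT i i.2, ← mul_pow]
    exact pow_le_pow_left₀ (norm_nonneg _) (hsmooth _ _ _) 2
  have hIH : ∀ t, 1 ≤ t → t ≤ T →
      I t ≤ L ^ 2 * η t ^ 2 / 2 * ∑ i ∈ range n, ‖m t (i + 1)‖ ^ 2 := by
    intro t h1 hT
    have h := sum_norm_sub_first_sq_le (h := fun i => m t (i + 1)) hn (hw1 t h1 hT)
    rw [hI]
    refine (hdrift t h1 hT _).trans ((mul_le_mul_of_nonneg_left h (sq_nonneg L)).trans_eq ?_)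
    ring
  have hJH : ∀ t, 1 ≤ t → t + 1 ≤ T →
      J (t + 1) ≤ L ^ 2 * η t ^ 2 * ∑ i ∈ range n, ‖m t (i + 1)‖ ^ 2 := by
    intro t h1 hT
    have h := sum_norm_sub_last_sq_le (h := fun i => m t (i + 1)) hn (hw1 t h1 (by omega))
    rw [hJ (t + 1) (by omega), Nat.add_sub_cancel, hw0 (t + 1) (by omega) hT,
      Nat.add_sub_cancel, hwt t h1 (by omega)]
    refine (hdrift t h1 (by omega) _).trans
      ((mul_le_mul_of_nonneg_left h (sq_nonneg L)).trans_eq ?_)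
    ring
  have hmean : ∀ t, 1 ≤ t → t ≤ T → n * ‖mt t‖ ^ 2 ≤ ∑ i ∈ range n, ‖g t i‖ ^ 2 := by
    intro t h1 hT
    have h := norm_sub_sq_le_of_step (x := v t) (h := g t) (c := -(n : ℝ)⁻¹)
      (fun i hi => by rw [hv1 t h1 hT i hi, neg_smul, sub_neg_eq_add]) (Nat.zero_le n) le_rfl
    rw [hv0 t h1 hT, ← hmt t h1 hT, zero_sub, norm_neg] at h
    refine (mul_le_mul_of_nonneg_left h hn'.le).trans_eq ?_
    push_cast
    field_simp
    ring
  have hH : ∀ t, 2 ≤ t → t ≤ T → ∑ i ∈ range n, ‖m t (i + 1)‖ ^ 2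
      ≤ 2 * (β * (I (t - 1) + K' (t - 1)) + (1 - β) * (I t + K' t)) := by
    intro t h2 hT
    calc ∑ i ∈ range n, ‖m t (i + 1)‖ ^ 2
        ≤ ∑ i ∈ range n, (β * ‖mt (t - 1)‖ ^ 2 + (1 - β) * ‖g t i‖ ^ 2) := by
          refine sum_le_sum fun i hi => ?_
          rw [hm1 t (by omega) hT i (mem_range.1 hi), hm0 t (by omega) hT]
          exact norm_convex_comb_sq_le hβ0 hβ1.le _ _
      _ = β * (n * ‖mt (t - 1)‖ ^ 2) + (1 - β) * ∑ i ∈ range n, ‖g t i‖ ^ 2 := by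
          rw [sum_add_distrib, sum_const, card_range, nsmul_eq_mul, ← mul_sum]
          ring
      _ ≤ β * (2 * (I (t - 1) + K' (t - 1))) + (1 - β) * (2 * (I t + K' t)) := by
          exact add_le_add (mul_le_mul_of_nonneg_left
            ((hmean (t - 1) (by omega) (by omega)).trans (hG _)) hβ0)
            (mul_le_mul_of_nonneg_left (hG t) hβ)
      _ = _ := by ring
  have hH1 : ∑ i ∈ range n, ‖m 1 (i + 1)‖ ^ 2 ≤ 2 * ((1 - β) ^ 2 * (I 1 + K' 1)) := by
    have h : ∑ i ∈ range n, ‖m 1 (i + 1)‖ ^ 2 = (1 - β) ^ 2 * ∑ i ∈ range n, ‖g 1 i‖ ^ 2 := by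
      rw [mul_sum]
      refine sum_congr rfl fun i hi => ?_
      rw [hm1 1 le_rfl hT i (mem_range.1 hi), hm0 1 le_rfl hT, Nat.sub_self, hmt0, smul_zero,
        zero_add, norm_smul, mul_pow, Real.norm_of_nonneg hβ]
    rw [h]
    linarith [mul_le_mul_of_nonneg_left (hG 1) (sq_nonneg (1 - β))]
  have hηξ : ∀ t, 2 ≤ t → t ≤ T → η t ^ 2 ≤ ξ t ^ 2 ∧ η (t - 1) ^ 2 ≤ ξ t ^ 2 := by
    intro t h2 hT
    rw [hξ t h2]
    exact ⟨pow_le_pow_left₀ (hηpos t (by omega) hT).le (le_max_left _ _) 2,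
      pow_le_pow_left₀ (hηpos (t - 1) (by omega) (by omega)).le (le_max_right _ _) 2⟩
  have hS0 : ∀ t, 0 ≤ I t + K' t := fun t => add_nonneg (hI0 t) (hK0 t)
  have hIbound : ∀ t, 2 ≤ t → t ≤ T →
      I t ≤ L ^ 2 * ξ t ^ 2 *
        (β * (I (t - 1) + K' (t - 1)) + 3 / 2 * (1 - β) * (I t + K' t)) := by
    intro t h2 hT
    have hA := mul_nonneg hβ0 (hS0 (t - 1))
    have hB := mul_nonneg hβ (hS0 t)
    calc I t ≤ L ^ 2 * η t ^ 2 / 2 * ∑ i ∈ range n, ‖m t (i + 1)‖ ^ 2 := hIH t (by omega) hT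
      _ ≤ L ^ 2 * η t ^ 2 / 2 *
          (2 * (β * (I (t - 1) + K' (t - 1)) + (1 - β) * (I t + K' t))) :=
          mul_le_mul_of_nonneg_left (hH t h2 hT) (by positivity)
      _ = L ^ 2 * η t ^ 2 * (β * (I (t - 1) + K' (t - 1)) + (1 - β) * (I t + K' t)) := by ring
      _ ≤ _ := mul_le_mul (mul_le_mul_of_nonneg_left (hηξ t h2 hT).1 (sq_nonneg L))
          (by linarith) (by positivity) (by positivity)
  have hIbound1 : I 1 ≤ 3 / 2 * L ^ 2 * ξ 1 ^ 2 * (1 - β) ^ 2 * (I 1 + K' 1) := by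
    have hB : 0 ≤ L ^ 2 * η 1 ^ 2 * ((1 - β) ^ 2 * (I 1 + K' 1)) :=
      mul_nonneg (by positivity) (mul_nonneg (sq_nonneg _) (hS0 1))
    rw [hξ1]
    have h := (hIH 1 le_rfl hT).trans (mul_le_mul_of_nonneg_left hH1 (by positivity))
    linarith
  refine ⟨hIbound, hIbound1, ?_, ?_, ?_, ?_⟩
  · intro t h3 hT
    obtain ⟨s, rfl⟩ : ∃ s, t = s + 1 := ⟨t - 1, by omega⟩
    have hA := mul_nonneg hβ0 (hS0 (s - 1))
    have hB := mul_nonneg hβ (hS0 s)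
    have hη := (hηξ (s + 1) (by omega) hT).2
    have hs : s + 1 - 2 = s - 1 := by omega
    rw [hs]
    rw [Nat.add_sub_cancel] at hη ⊢
    calc J (s + 1) ≤ L ^ 2 * η s ^ 2 * ∑ i ∈ range n, ‖m s (i + 1)‖ ^ 2 :=
          hJH s (by omega) hT
      _ ≤ L ^ 2 * ξ (s + 1) ^ 2 *
          (3 * (β * (I (s - 1) + K' (s - 1)) + (1 - β) * (I s + K' s))) :=
          mul_le_mul (mul_le_mul_of_nonneg_left hη (sq_nonneg L))
            ((hH s (by omega) (by omega)).trans (by linarith)) (by positivity) (by positivity)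
      _ = _ := by ring
  · intro hT2
    have hη := (hηξ 2 le_rfl hT2).2
    have hsq : (1 - β) ^ 2 ≤ 1 := pow_le_one₀ hβ (by linarith)
    have hB := mul_le_mul_of_nonneg_right hsq (hS0 1)
    calc J 2 ≤ L ^ 2 * η 1 ^ 2 * ∑ i ∈ range n, ‖m 1 (i + 1)‖ ^ 2 := hJH 1 le_rfl hT2
      _ ≤ L ^ 2 * ξ 2 ^ 2 * (3 * (I 1 + K' 1)) :=
          mul_le_mul (mul_le_mul_of_nonneg_left hη (sq_nonneg L))
            (hH1.trans (by linarith [hS0 1])) (by positivity) (by positivity)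
      _ = _ := by ring
  · intro t h2 hT hL2
    have hA := mul_nonneg hβ0 (hS0 (t - 1))
    have hB := mul_nonneg hβ (hS0 t)
    have h := (hIbound t h2 hT).trans (mul_le_mul_of_nonneg_right hL2 (by linarith))
    have hβA := mul_nonneg hβ0 hA
    have hβK := mul_nonneg hβ0 (mul_nonneg hβ (hK0 t))
    by_contra! hlt
    have hmul := mul_lt_mul_of_pos_left hlt (by linarith : 0 < 2 + 3 * β)
    nlinarith
  · intro hL2
    have hsq : (1 - β) ^ 2 ≤ 1 - β := by nlinarith
    have h1 : 3 / 2 * L ^ 2 * ξ 1 ^ 2 * (1 - β) ^ 2 * (I 1 + K' 1)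
        ≤ 2 / 5 * (3 / 2 * ((1 - β) * (I 1 + K' 1))) := by
      calc _ = L ^ 2 * ξ 1 ^ 2 * (3 / 2 * ((1 - β) ^ 2 * (I 1 + K' 1))) := by ring
        _ ≤ _ := mul_le_mul hL2 (by linarith [mul_le_mul_of_nonneg_right hsq (hS0 1)])
            (mul_nonneg (by norm_num) (mul_nonneg (sq_nonneg _) (hS0 1))) (by norm_num)
    have h := hIbound1.trans h1
    have hβK := mul_nonneg hβ0 (mul_nonneg hβ (hK0 1))
    by_contra! hlt
    have hmul := mul_lt_mul_of_pos_left hlt (by linarith : 0 < 2 + 3 * β)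
    nlinarith
end

section
/- Under assumptions (a)–(c) and the SMG iterates with arbitrary permutations, suppose η_0 := η_1, η_t ≥ η_{t+1} for 1 ≤ t ≤ T−1, and 0 < η_t ≤ 1/(L·√K) for all t, where K := max{5/2, 9(5−3β)(Θ+1)/(1−β)}. Then (η_1/2)·‖∇F(w̃_0)‖² ≤ (F(w̃_0) − F(w̃_1))/(1−β) + ((1−β)·η_1/4)·‖∇F(w̃_0)‖² + (9·σ²·(5−3β)·L²/(4·(1−β)))·ξ_1³, where ξ_1 := η_1. -/
open Finset

/-- The descent lemma for a differentiable function with Lipschitz gradient. -/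
theorem le_add_inner_gradient_add_sq {E : Type*} [NormedAddCommGroup E] [InnerProductSpace ℝ E]
    [CompleteSpace E] {F : E → ℝ} {L : ℝ} (hF : Differentiable ℝ F)
    (hL : ∀ x y, ‖gradient F x - gradient F y‖ ≤ L * ‖x - y‖) (x u : E) :
    F (x + u) ≤ F x + inner ℝ (gradient F x) u + L / 2 * ‖u‖ ^ 2 := by
  set φ : ℝ → ℝ := fun t =>
    F (x + t • u) - t * inner ℝ (gradient F x) u - L / 2 * ‖u‖ ^ 2 * t ^ 2 with hφ
  have hderiv (t : ℝ) : HasDerivAt φ (inner ℝ (gradient F (x + t • u)) u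
      - inner ℝ (gradient F x) u - L * ‖u‖ ^ 2 * t) t := by
    have hline : HasDerivAt (fun t : ℝ => x + t • u) u t := by
      simpa using ((hasDerivAt_id t).smul_const u).const_add x
    have hcomp := (hF (x + t • u)).hasGradientAt.hasFDerivAt.comp_hasDerivAt t hline
    have hlin := (hasDerivAt_id t).mul_const (inner ℝ (gradient F x) u)
    have hquad := (hasDerivAt_pow 2 t).const_mul (L / 2 * ‖u‖ ^ 2)
    refine ((hcomp.sub hlin).sub hquad).congr_deriv ?_
    simp only [InnerProductSpace.toDual_apply_apply]
    push_cast
    ring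
  have hanti : AntitoneOn φ (Set.Icc 0 1) := by
    refine antitoneOn_of_deriv_nonpos (convex_Icc 0 1)
      (fun t _ => (hderiv t).continuousAt.continuousWithinAt)
      (fun t _ => (hderiv t).differentiableAt.differentiableWithinAt) fun t ht => ?_
    rw [interior_Icc] at ht
    rw [(hderiv t).deriv, ← inner_sub_left]
    have hcs := real_inner_le_norm (gradient F (x + t • u) - gradient F x) u
    have hlip := hL (x + t • u) x
    rw [add_sub_cancel_left, norm_smul, Real.norm_of_nonneg ht.1.le] at hlip
    nlinarith [mul_le_mul_of_nonneg_right hlip (norm_nonneg u)]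
  have h := hanti (Set.left_mem_Icc.2 zero_le_one) (Set.right_mem_Icc.2 zero_le_one) zero_le_one
  simp only [hφ, one_smul, zero_smul, add_zero] at h
  linarith

/-- One gradient-like step `-a • G` with `L * a ≤ 1`. -/
theorem descent_inexact_step {E : Type*} [NormedAddCommGroup E] [InnerProductSpace ℝ E]
    [CompleteSpace E] {F : E → ℝ} {L a : ℝ} (hF : Differentiable ℝ F)
    (hL : ∀ x y, ‖gradient F x - gradient F y‖ ≤ L * ‖x - y‖) (ha : 0 ≤ a) (hLa : L * a ≤ 1)
    (x G : E) :
    a / 2 * ‖gradient F x‖ ^ 2 ≤ F x - F (x - a • G) + a / 2 * ‖gradient F x - G‖ ^ 2 := by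
  have h := le_add_inner_gradient_add_sq hF hL x (-(a • G))
  rw [← sub_eq_add_neg, inner_neg_right, inner_smul_right, norm_neg, norm_smul,
    Real.norm_of_nonneg ha] at h
  rw [norm_sub_sq_real]
  nlinarith [mul_nonneg (mul_nonneg ha (sub_nonneg.2 hLa)) (sq_nonneg ‖G‖)]

theorem norm_sum_sq_le_card_mul_sum {ι E : Type*} [SeminormedAddCommGroup E] (s : Finset ι)
    (x : ι → E) : ‖∑ i ∈ s, x i‖ ^ 2 ≤ #s * ∑ i ∈ s, ‖x i‖ ^ 2 :=
  (pow_le_pow_left₀ (norm_nonneg _) (norm_sum_le _ _) 2).trans sq_sum_le_card_mul_sum_sq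

theorem norm_add₃_sq_le {E : Type*} [SeminormedAddCommGroup E] (x y z : E) :
    ‖x + y + z‖ ^ 2 ≤ 3 * (‖x‖ ^ 2 + ‖y‖ ^ 2 + ‖z‖ ^ 2) := by
  have h := pow_le_pow_left₀ (norm_nonneg _) (norm_add₃_le (a := x) (b := y) (c := z)) 2
  nlinarith [sq_nonneg (‖x‖ - ‖y‖), sq_nonneg (‖x‖ - ‖z‖), sq_nonneg (‖y‖ - ‖z‖)]

theorem hasGradientAt_const_mul_sum {ι E : Type*} [Fintype ι] [NormedAddCommGroup E]
    [InnerProductSpace ℝ E] [CompleteSpace E] {f : ι → E → ℝ}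
    (hf : ∀ i, Differentiable ℝ (f i)) (c : ℝ) (x : E) :
    HasGradientAt (fun y => c * ∑ i, f i y) (c • ∑ i, gradient (f i) x) x := by
  rw [hasGradientAt_iff_hasFDerivAt]
  have h := (HasFDerivAt.fun_sum (u := univ)
    fun i _ => (hf i x).hasGradientAt.hasFDerivAt).const_mul c
  simpa using h

/-- Closed form of an incremental pass. -/
theorem incremental_eq_sub_smul_sum {E : Type*} [AddCommGroup E] [Module ℝ E]
    {n : ℕ} {c : ℝ} {w g : ℕ → E} (hw : ∀ i < n, w (i + 1) = w i - c • g i) :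
    ∀ i ≤ n, w i = w 0 - c • ∑ j ∈ range i, g j := by
  intro i
  induction i with
  | zero => simp
  | succ i ih =>
    intro hi
    rw [hw i hi, ih (by omega), sum_range_succ, smul_add]
    abel

/-- The drift of an incremental pass is controlled by the squared sizes of its directions. -/
theorem sum_norm_sub_sq_le_of_incremental {E : Type*} [NormedAddCommGroup E] [NormedSpace ℝ E]
    {n : ℕ} (hn : 1 ≤ n) {a : ℝ} {w g : ℕ → E}
    (hw : ∀ i < n, w (i + 1) = w i - (a / n) • g i) :
    ∑ i ∈ range n, ‖w i - w 0‖ ^ 2 ≤ a ^ 2 * ∑ i ∈ range n, ‖g i‖ ^ 2 := by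
  have hnpos : (0 : ℝ) < n := by exact_mod_cast hn
  have hterm : ∀ i ∈ range n, ‖w i - w 0‖ ^ 2 ≤ a ^ 2 / n * ∑ j ∈ range n, ‖g j‖ ^ 2 := by
    intro i hi
    have hin := (mem_range.1 hi).le
    have hsum : ‖∑ j ∈ range i, g j‖ ^ 2 ≤ n * ∑ j ∈ range n, ‖g j‖ ^ 2 := by
      refine (norm_sum_sq_le_card_mul_sum _ _).trans ?_
      rw [card_range]
      gcongr
    rw [incremental_eq_sub_smul_sum hw i hin, sub_sub_cancel_left, norm_neg, norm_smul, mul_pow, Real.norm_eq_abs, sq_abs]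
    calc (a / n) ^ 2 * ‖∑ j ∈ range i, g j‖ ^ 2
        ≤ (a / n) ^ 2 * (n * ∑ j ∈ range n, ‖g j‖ ^ 2) := by gcongr
      _ = _ := by field_simp
  refine (sum_le_sum hterm).trans_eq ?_
  rw [sum_const, card_range, nsmul_eq_mul]
  field_simp

/-- Consequences of the step-size cap: `L η ≤ 1` and the bound on `L ^ 2 η ^ 2`. -/
theorem step_size_bounds {L η K c : ℝ} (hL : 0 < L) (hη : 0 < η) (hK1 : 1 ≤ K) (hcK : c ≤ K)
    (hηK : η ≤ 1 / (L * √K)) : L * η ≤ 1 ∧ c * (L * η) ^ 2 ≤ 1 := by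
  have hs : 1 ≤ √K := Real.one_le_sqrt.2 hK1
  have h : L * η * √K ≤ 1 := by
    rw [le_div_iff₀ (by positivity)] at hηK
    linarith
  have hLη : 0 < L * η := mul_pos hL hη
  refine ⟨by nlinarith, ?_⟩
  have hsq : (L * η * √K) ^ 2 ≤ 1 := pow_le_one₀ (by positivity) h
  rw [mul_pow, Real.sq_sqrt (by linarith)] at hsq
  nlinarith [sq_nonneg (L * η)]

/-- The scalar estimate that absorbs the drift `D` of one pass into the step-size condition. -/
theorem drift_bound {L η β Θ σ N D : ℝ} (hβ0 : 0 ≤ β) (hβ1 : β < 1) (hΘ : 0 ≤ Θ)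
    (hstep : 9 * (5 - 3 * β) * (Θ + 1) / (1 - β) * (L * η) ^ 2 ≤ 1)
    (hD0 : 0 ≤ D)
    (hD : D ≤ 3 * ((1 - β) * η) ^ 2 * (L ^ 2 * D + (Θ + 1) * N ^ 2 + σ ^ 2)) :
    L ^ 2 * D ≤ (1 - β) / 2 * N ^ 2 + 9 * (5 - 3 * β) / (2 * (1 - β)) * (L * η) ^ 2 * σ ^ 2 := by
  have hb : 0 < 1 - β := by linarith
  set q := (L * η) ^ 2 with hq
  have hq0 : 0 ≤ q := sq_nonneg _
  have hstep' : 9 * (5 - 3 * β) * (Θ + 1) * q ≤ 1 - β := by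
    rw [div_mul_eq_mul_div, div_le_one hb] at hstep
    exact hstep
  have hΘq : 18 * ((Θ + 1) * q) ≤ 1 - β := by
    nlinarith [mul_nonneg (by linarith : 0 ≤ Θ + 1) hq0]
  have hq18 : 18 * q ≤ 1 := by nlinarith [mul_nonneg hΘ hq0]
  have hb2 : (1 - β) ^ 2 ≤ 1 := pow_le_one₀ hb.le (by linarith)
  have hLD : L ^ 2 * D ≤ 3 * q * (L ^ 2 * D + (Θ + 1) * N ^ 2 + σ ^ 2) := by
    have hS : 0 ≤ L ^ 2 * D + (Θ + 1) * N ^ 2 + σ ^ 2 := by positivity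
    calc L ^ 2 * D
        ≤ L ^ 2 * (3 * ((1 - β) * η) ^ 2 * (L ^ 2 * D + (Θ + 1) * N ^ 2 + σ ^ 2)) := by gcongr
      _ = (1 - β) ^ 2 * (3 * q * (L ^ 2 * D + (Θ + 1) * N ^ 2 + σ ^ 2)) := by rw [hq]; ring
      _ ≤ 1 * (3 * q * (L ^ 2 * D + (Θ + 1) * N ^ 2 + σ ^ 2)) := by gcongr
      _ = _ := one_mul _
  have hLD0 : 0 ≤ L ^ 2 * D := by positivity
  have hsolve : L ^ 2 * D ≤ 18 / 5 * ((Θ + 1) * q * N ^ 2 + q * σ ^ 2) := by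
    nlinarith [mul_le_mul_of_nonneg_right hq18 hLD0]
  have hcoef : 9 ≤ 9 * (5 - 3 * β) / (2 * (1 - β)) := by
    rw [le_div_iff₀ (by positivity)]
    linarith
  have hN := mul_le_mul_of_nonneg_right hΘq (sq_nonneg N)
  have hN0 : 0 ≤ (1 - β) * N ^ 2 := by positivity
  have hσ := mul_le_mul_of_nonneg_right hcoef (by positivity : 0 ≤ q * σ ^ 2)
  have hσ0 : 0 ≤ q * σ ^ 2 := by positivity
  nlinarith

theorem smg_lemma6
    (n d : ℕ) (hn : 1 ≤ n) (hd : 1 ≤ d)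
    (f : Fin n → EuclideanSpace ℝ (Fin d) → ℝ)
    (hf : ∀ i, Differentiable ℝ (f i))
    (F : EuclideanSpace ℝ (Fin d) → ℝ)
    (hF : F = fun x => (1 / (n : ℝ)) * ∑ i, f i x)
    (L : ℝ) (hL : 0 < L)
    (hsmooth : ∀ i x y, ‖gradient (f i) x - gradient (f i) y‖ ≤ L * ‖x - y‖)
    (Θ σ : ℝ) (hΘ : 0 ≤ Θ) (hσ : 0 ≤ σ)
    (hvar : ∀ x, (1 / (n : ℝ)) * ∑ i, ‖gradient (f i) x - gradient F x‖ ^ 2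
        ≤ Θ * ‖gradient F x‖ ^ 2 + σ ^ 2)
    (Fstar : ℝ) (hFstar : IsGLB (Set.range F) Fstar)
    (T : ℕ) (hT : 1 ≤ T)
    (β : ℝ) (hβ0 : 0 ≤ β) (hβ1 : β < 1)
    (η : ℕ → ℝ) (hηpos : ∀ t, 1 ≤ t → t ≤ T → 0 < η t)
    (π : ℕ → Equiv.Perm (Fin n))
    (w m v g : ℕ → ℕ → EuclideanSpace ℝ (Fin d))
    (wt mt : ℕ → EuclideanSpace ℝ (Fin d))
    (hmt0 : mt 0 = 0)
    (hw0 : ∀ t, 1 ≤ t → t ≤ T → w t 0 = wt (t - 1))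
    (hm0 : ∀ t, 1 ≤ t → t ≤ T → m t 0 = mt (t - 1))
    (hv0 : ∀ t, 1 ≤ t → t ≤ T → v t 0 = 0)
    (hg : ∀ t, 1 ≤ t → t ≤ T → ∀ i, ∀ hi : i < n,
        g t i = gradient (f (π t ⟨i, hi⟩)) (w t i))
    (hm1 : ∀ t, 1 ≤ t → t ≤ T → ∀ i, i < n →
        m t (i + 1) = β • m t 0 + (1 - β) • g t i)
    (hv1 : ∀ t, 1 ≤ t → t ≤ T → ∀ i, i < n →
        v t (i + 1) = v t i + ((n : ℝ))⁻¹ • g t i)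
    (hw1 : ∀ t, 1 ≤ t → t ≤ T → ∀ i, i < n →
        w t (i + 1) = w t i - (η t / (n : ℝ)) • m t (i + 1))
    (hwt : ∀ t, 1 ≤ t → t ≤ T → wt t = w t n)
    (hmt : ∀ t, 1 ≤ t → t ≤ T → mt t = v t n)
    (K : ℝ) (hKdef : K = max (5 / 2) (9 * (5 - 3 * β) * (Θ + 1) / (1 - β)))
    (hη0 : η 0 = η 1)
    (hηdec : ∀ t, 1 ≤ t → t ≤ T - 1 → η (t + 1) ≤ η t)
    (hηK : ∀ t, 1 ≤ t → t ≤ T → η t ≤ 1 / (L * Real.sqrt K)) :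
    η 1 / 2 * ‖gradient F (wt 0)‖ ^ 2
      ≤ (F (wt 0) - F (wt 1)) / (1 - β)
        + (1 - β) * η 1 / 4 * ‖gradient F (wt 0)‖ ^ 2
        + 9 * σ ^ 2 * (5 - 3 * β) * L ^ 2 / (4 * (1 - β)) * η 1 ^ 3 := by
  have hnpos : (0 : ℝ) < n := by exact_mod_cast hn
  have hb : 0 < 1 - β := by linarith
  have hη : 0 < η 1 := hηpos 1 le_rfl hT
  have hgradF (x) : gradient F x = (1 / (n : ℝ)) • ∑ i, gradient (f i) x := by
    rw [hF]
    exact (hasGradientAt_const_mul_sum hf _ x).gradient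
  have hFdiff : Differentiable ℝ F := by
    rw [hF]
    exact fun x => (hasGradientAt_const_mul_sum hf _ x).differentiableAt
  have hFsmooth (x y) : ‖gradient F x - gradient F y‖ ≤ L * ‖x - y‖ := by
    rw [hgradF, hgradF, ← smul_sub, ← sum_sub_distrib, norm_smul,
      Real.norm_of_nonneg (by positivity)]
    calc 1 / (n : ℝ) * ‖∑ i, (gradient (f i) x - gradient (f i) y)‖
        ≤ 1 / (n : ℝ) * ∑ _i : Fin n, L * ‖x - y‖ := by
          gcongr
          exact norm_sum_le_of_le _ fun i _ => hsmooth i x y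
      _ = L * ‖x - y‖ := by
          rw [sum_const, card_univ, Fintype.card_fin, nsmul_eq_mul]
          field_simp
  have hK1 : 1 ≤ K := by
    rw [hKdef]
    exact le_max_of_le_left (by norm_num)
  obtain ⟨hLη, hstep⟩ := step_size_bounds hL hη hK1 (hKdef ▸ le_max_right _ _) (hηK 1 le_rfl hT)
  have hw10 : w 1 0 = wt 0 := hw0 1 le_rfl hT
  have hm10 : m 1 0 = 0 := (hm0 1 le_rfl hT).trans hmt0
  have hpass : ∀ i < n, w 1 (i + 1) = w 1 i - ((1 - β) * η 1 / n) • g 1 i := by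
    intro i hi
    rw [hw1 1 le_rfl hT i hi, hm1 1 le_rfl hT i hi, hm10, smul_zero, zero_add, smul_smul]
    congr 2
    ring
  have hdrift := sum_norm_sub_sq_le_of_incremental hn hpass
  set x := wt 0
  set G := (1 / (n : ℝ)) • ∑ j ∈ range n, g 1 j with hG
  have hend : wt 1 = x - ((1 - β) * η 1) • G := by
    rw [hwt 1 le_rfl hT, incremental_eq_sub_smul_sum hpass n le_rfl, hw10, hG, smul_smul]
    congr 2
    ring
  have hdesc := descent_inexact_step hFdiff hFsmooth (a := (1 - β) * η 1) (by positivity)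
    (by nlinarith [mul_pos hL hη]) x G
  rw [← hend] at hdesc
  rw [hw10] at hdrift
  set D := 1 / (n : ℝ) * ∑ i ∈ range n, ‖w 1 i - x‖ ^ 2 with hDdef
  have hgi (i : Fin n) : g 1 i = gradient (f (π 1 i)) (w 1 i) := hg 1 le_rfl hT i i.2
  have hgsmooth (i : Fin n) :
      ‖g 1 i - gradient (f (π 1 i)) x‖ ^ 2 ≤ L ^ 2 * ‖w 1 i - x‖ ^ 2 := by
    rw [hgi, ← mul_pow]
    exact pow_le_pow_left₀ (norm_nonneg _) (hsmooth _ _ _) 2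
  have hsmoothsum : ∑ i : Fin n, ‖g 1 i - gradient (f (π 1 i)) x‖ ^ 2 ≤ n * (L ^ 2 * D) := by
    refine (sum_le_sum fun i _ => hgsmooth i).trans_eq ?_
    rw [← mul_sum, hDdef, sum_range]
    field_simp
  have herr : ‖gradient F x - G‖ ^ 2 ≤ L ^ 2 * D := by
    have hdiff : gradient F x - G
        = -((1 / (n : ℝ)) • ∑ i : Fin n, (g 1 i - gradient (f (π 1 i)) x)) := by
      rw [hG, hgradF, sum_range, sum_sub_distrib,
        Equiv.sum_comp (π 1) fun i => gradient (f i) x, smul_sub, neg_sub]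
    rw [hdiff, norm_neg, norm_smul, mul_pow, Real.norm_eq_abs, sq_abs]
    have hcs := norm_sum_sq_le_card_mul_sum univ
      fun i : Fin n => g 1 i - gradient (f (π 1 i)) x
    rw [card_univ, Fintype.card_fin] at hcs
    calc _ ≤ (1 / (n : ℝ)) ^ 2 * (n * (n * (L ^ 2 * D))) := by
          gcongr
          exact hcs.trans (by gcongr)
      _ = L ^ 2 * D := by field_simp
  have hvarsum : ∑ i, ‖gradient (f (π 1 i)) x - gradient F x‖ ^ 2
      ≤ n * (Θ * ‖gradient F x‖ ^ 2 + σ ^ 2) := by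
    rw [Equiv.sum_comp (π 1) fun i => ‖gradient (f i) x - gradient F x‖ ^ 2]
    have h := hvar x
    rwa [one_div, inv_mul_le_iff₀ hnpos] at h
  have hgsum : ∑ i ∈ range n, ‖g 1 i‖ ^ 2
      ≤ 3 * n * (L ^ 2 * D + (Θ + 1) * ‖gradient F x‖ ^ 2 + σ ^ 2) := by
    rw [sum_range]
    have hsplit (i : Fin n) : ‖g 1 i‖ ^ 2 ≤ 3 * (‖g 1 i - gradient (f (π 1 i)) x‖ ^ 2
        + ‖gradient (f (π 1 i)) x - gradient F x‖ ^ 2 + ‖gradient F x‖ ^ 2) := by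
      have h := norm_add₃_sq_le (g 1 i - gradient (f (π 1 i)) x)
        (gradient (f (π 1 i)) x - gradient F x) (gradient F x)
      rwa [sub_add_sub_cancel, sub_add_cancel] at h
    refine (sum_le_sum fun i _ => hsplit i).trans ?_
    rw [← mul_sum, sum_add_distrib, sum_add_distrib, sum_const, card_univ, Fintype.card_fin,
      nsmul_eq_mul]
    linarith
  have hD : D ≤ 3 * ((1 - β) * η 1) ^ 2
      * (L ^ 2 * D + (Θ + 1) * ‖gradient F x‖ ^ 2 + σ ^ 2) := by
    calc D ≤ 1 / (n : ℝ) * (((1 - β) * η 1) ^ 2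
          * (3 * n * (L ^ 2 * D + (Θ + 1) * ‖gradient F x‖ ^ 2 + σ ^ 2))) := by
          rw [hDdef]
          gcongr
          exact hdrift.trans (by gcongr)
      _ = _ := by field_simp
  have hfinal := herr.trans (drift_bound hβ0 hβ1 hΘ hstep (by positivity) hD)
  have hdiv : η 1 / 2 * ‖gradient F x‖ ^ 2
      ≤ (F x - F (wt 1)) / (1 - β) + η 1 / 2 * ‖gradient F x - G‖ ^ 2 := by
    rw [← sub_le_iff_le_add, le_div_iff₀ hb]
    linarith
  have hscale := mul_le_mul_of_nonneg_left hfinal (half_pos hη).le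
  have hrw : η 1 / 2 * ((1 - β) / 2 * ‖gradient F x‖ ^ 2
        + 9 * (5 - 3 * β) / (2 * (1 - β)) * (L * η 1) ^ 2 * σ ^ 2)
      = (1 - β) * η 1 / 4 * ‖gradient F x‖ ^ 2
        + 9 * σ ^ 2 * (5 - 3 * β) * L ^ 2 / (4 * (1 - β)) * η 1 ^ 3 := by
    field_simp
    ring
  linarith
end

section
/- Under assumptions (a)–(c) and the SMG iterates driven by randomized reshuffling, suppose η_0 := η_1, η_t ≥ η_{t+1} for 1 ≤ t ≤ T−1, and 0 < η_t ≤ 1/(L·√D) for all t, where D := max{5/3, 6(5−3β)(Θ+n)/(n(1−β))}. Then (1/Σ_{t=1}^T η_t) · Σ_{t=1}^T η_t·𝔼[‖∇F(w̃_{t−1})‖²] ≤ 4·(F(w̃_0) − F_*)/((1−β)·Σ_{t=1}^T η_t) + (6·σ²·(5−3β)·L²/(n·(1−β))) · (Σ_{t=1}^T η_{t−1}³)/(Σ_{t=1}^T η_t). -/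
open Finset

section NormInequalities

variable {V : Type*} [NormedAddCommGroup V]

lemma norm_convex_comb_sq_le_s11 [NormedSpace ℝ V] {β : ℝ} (hβ0 : 0 ≤ β) (hβ1 : β ≤ 1) (a b : V) :
    ‖β • a + (1 - β) • b‖ ^ 2 ≤ β * ‖a‖ ^ 2 + (1 - β) * ‖b‖ ^ 2 := by
  have h : ‖β • a + (1 - β) • b‖ ≤ β * ‖a‖ + (1 - β) * ‖b‖ := by
    refine (norm_add_le _ _).trans_eq ?_
    rw [norm_smul, norm_smul, Real.norm_of_nonneg hβ0, Real.norm_of_nonneg (by linarith)]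
  have h2 := pow_le_pow_left₀ (norm_nonneg _) h 2
  nlinarith [mul_nonneg (mul_nonneg hβ0 (sub_nonneg.2 hβ1)) (sq_nonneg (‖a‖ - ‖b‖))]

lemma norm_sum_sq_le {ι : Type*} (s : Finset ι) (x : ι → V) :
    ‖∑ i ∈ s, x i‖ ^ 2 ≤ (#s : ℝ) * ∑ i ∈ s, ‖x i‖ ^ 2 :=
  (pow_le_pow_left₀ (norm_nonneg _) (norm_sum_le _ _) 2).trans sq_sum_le_card_mul_sum_sq

lemma norm_add_sq_le_two (a b : V) : ‖a + b‖ ^ 2 ≤ 2 * ‖a‖ ^ 2 + 2 * ‖b‖ ^ 2 := by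
  have h2 := pow_le_pow_left₀ (norm_nonneg _) (norm_add_le a b) 2
  nlinarith [sq_nonneg (‖a‖ - ‖b‖)]

lemma norm_add_sq_le_three (a b c : V) :
    ‖a + b + c‖ ^ 2 ≤ 3 * (‖a‖ ^ 2 + ‖b‖ ^ 2 + ‖c‖ ^ 2) := by
  have h2 := pow_le_pow_left₀ (norm_nonneg _) (norm_add₃_le (a := a) (b := b) (c := c)) 2
  nlinarith [sq_nonneg (‖a‖ - ‖b‖), sq_nonneg (‖a‖ - ‖c‖), sq_nonneg (‖b‖ - ‖c‖)]

/-- Averages of vectors that are pairwise close are close in mean square. -/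
lemma norm_avg_sub_avg_sq_le [NormedSpace ℝ V] {n : ℕ} (hn : 1 ≤ n) (x y : ℕ → V) (r : ℕ → ℝ)
    (L : ℝ) (hxy : ∀ i < n, ‖x i - y i‖ ≤ L * r i) :
    ‖(n : ℝ)⁻¹ • ∑ i ∈ range n, x i - (n : ℝ)⁻¹ • ∑ i ∈ range n, y i‖ ^ 2
      ≤ L ^ 2 / n * ∑ i ∈ range n, r i ^ 2 := by
  have hn' : (0 : ℝ) < n := by exact_mod_cast hn
  rw [← smul_sub, ← sum_sub_distrib, norm_smul, mul_pow, norm_inv, RCLike.norm_natCast]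
  have h1 := norm_sum_sq_le (range n) (fun i => x i - y i)
  rw [card_range] at h1
  have h2 : ∑ i ∈ range n, ‖x i - y i‖ ^ 2 ≤ L ^ 2 * ∑ i ∈ range n, r i ^ 2 := by
    rw [mul_sum]
    refine sum_le_sum fun i hi => ?_
    rw [← mul_pow]
    exact pow_le_pow_left₀ (norm_nonneg _) (hxy i (mem_range.1 hi)) 2
  calc _ ≤ (n : ℝ)⁻¹ ^ 2 * (n * (L ^ 2 * ∑ i ∈ range n, r i ^ 2)) := by
        gcongr
        exact h1.trans (by gcongr)
    _ = _ := by field_simp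

end NormInequalities

section Permutations

variable {V : Type*} [NormedAddCommGroup V] [InnerProductSpace ℝ V]
variable {ι : Type*} [Fintype ι] [DecidableEq ι]

/-- Entries of a centered family sampled without replacement are nonpositively correlated. -/
lemma sum_perm_inner_nonpos (u : ι → V) (hu : ∑ i, u i = 0) {j k : ι} (hjk : j ≠ k) :
    ∑ τ : Equiv.Perm ι, inner ℝ (u (τ j)) (u (τ k)) ≤ 0 := by
  set C : ι → ℝ := fun l => ∑ τ : Equiv.Perm ι, inner ℝ (u (τ j)) (u (τ l)) with hC
  have hconst : ∀ l, l ≠ j → C l = C k := by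
    intro l hl
    simp only [hC]
    rw [← Equiv.sum_comp (Equiv.mulRight (Equiv.swap k l))]
    refine sum_congr rfl fun τ _ => ?_
    simp [Equiv.swap_apply_of_ne_of_ne hjk hl.symm]
  have htotal : ∑ l, C l = 0 := by
    simp only [hC]
    rw [sum_comm]
    refine sum_eq_zero fun τ _ => ?_
    rw [← inner_sum, Equiv.sum_comp τ u, hu, inner_zero_right]
  have hself : 0 ≤ C j := sum_nonneg fun τ _ => real_inner_self_nonneg
  rw [← add_sum_erase _ _ (mem_univ j),
    sum_congr rfl (fun l hl => hconst l (ne_of_mem_erase hl)), sum_const, nsmul_eq_mul] at htotal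
  have hcard : (0 : ℝ) < #(univ.erase j) := by
    exact_mod_cast card_pos.2 ⟨k, mem_erase.2 ⟨hjk.symm, mem_univ k⟩⟩
  change C k ≤ 0
  by_contra! h
  nlinarith [mul_pos hcard h]

lemma sum_perm_norm_sum_sq_le (u : ι → V) (hu : ∑ i, u i = 0) (S : Finset ι) :
    ∑ τ : Equiv.Perm ι, ‖∑ j ∈ S, u (τ j)‖ ^ 2
      ≤ (Fintype.card (Equiv.Perm ι) : ℝ) * ∑ j, ‖u j‖ ^ 2 := by
  calc ∑ τ : Equiv.Perm ι, ‖∑ j ∈ S, u (τ j)‖ ^ 2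
      = ∑ j ∈ S, ∑ k ∈ S, ∑ τ : Equiv.Perm ι, inner ℝ (u (τ j)) (u (τ k)) := by
        simp_rw [← real_inner_self_eq_norm_sq, sum_inner, inner_sum]
        rw [sum_comm]
        exact sum_congr rfl fun j _ => sum_comm
    _ ≤ ∑ j ∈ S, ∑ τ : Equiv.Perm ι, inner ℝ (u (τ j)) (u (τ j)) := by
        refine sum_le_sum fun j hj => ?_
        rw [← add_sum_erase _ _ hj]
        have := sum_nonpos fun k (hk : k ∈ S.erase j) =>
          sum_perm_inner_nonpos u hu (ne_of_mem_erase hk).symm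
        linarith
    _ ≤ ∑ j, ∑ τ : Equiv.Perm ι, inner ℝ (u (τ j)) (u (τ j)) :=
        sum_le_sum_of_subset_of_nonneg (subset_univ S) fun j _ _ =>
          sum_nonneg fun τ _ => real_inner_self_nonneg
    _ = _ := by
        rw [sum_comm]
        simp_rw [real_inner_self_eq_norm_sq]
        rw [sum_congr rfl fun τ _ => Equiv.sum_comp τ fun j => ‖u j‖ ^ 2]
        simp

/-- Variance bound for partial sums of a centered family that is shuffled by the `k`-th of
several independent uniform permutations and does not depend on that permutation. -/
lemma sum_pi_perm_norm_sum_sq_le {κ : Type*} [Fintype κ] [DecidableEq κ] (k : κ)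
    (u : (κ → Equiv.Perm ι) → ι → V) (hu : ∀ ω, ∑ i, u ω i = 0)
    (hinv : ∀ ω τ, u (ω * Pi.mulSingle k τ) = u ω) (S : Finset ι) :
    ∑ ω : κ → Equiv.Perm ι, ‖∑ j ∈ S, u ω (ω k j)‖ ^ 2
      ≤ ∑ ω : κ → Equiv.Perm ι, ∑ j, ‖u ω j‖ ^ 2 := by
  have hc : (0 : ℝ) < Fintype.card (Equiv.Perm ι) := by exact_mod_cast Fintype.card_pos
  refine le_of_mul_le_mul_left ?_ hc
  calc _ = ∑ τ : Equiv.Perm ι, ∑ ω : κ → Equiv.Perm ι, ‖∑ j ∈ S, u ω (ω k j)‖ ^ 2 := by simp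
    _ = ∑ τ : Equiv.Perm ι, ∑ ω : κ → Equiv.Perm ι, ‖∑ j ∈ S, u ω (ω k (τ j))‖ ^ 2 := by
        refine sum_congr rfl fun τ _ => ?_
        rw [← Equiv.sum_comp (Equiv.mulRight (Pi.mulSingle k τ))]
        refine sum_congr rfl fun ω _ => ?_
        simp [hinv]
    _ = ∑ ω : κ → Equiv.Perm ι, ∑ τ : Equiv.Perm ι, ‖∑ j ∈ S, u ω (ω k (τ j))‖ ^ 2 := sum_comm
    _ ≤ ∑ ω : κ → Equiv.Perm ι, (Fintype.card (Equiv.Perm ι) : ℝ) * ∑ j, ‖u ω j‖ ^ 2 := by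
        refine sum_le_sum fun ω _ => ?_
        have h := sum_perm_norm_sum_sq_le (u ω ∘ ω k)
          (by rw [← hu ω]; exact Equiv.sum_comp (ω k) (u ω)) S
        refine h.trans_eq ?_
        congr 1
        exact Equiv.sum_comp (ω k) fun j => ‖u ω j‖ ^ 2
    _ = _ := by rw [mul_sum]

end Permutations

section Smoothness

variable {V : Type*} [NormedAddCommGroup V] [InnerProductSpace ℝ V] [CompleteSpace V]

lemma le_add_inner_gradient_add {F : V → ℝ} (hF : Differentiable ℝ F) {L : ℝ} (hL : 0 ≤ L)
    (hlip : ∀ x y, ‖gradient F x - gradient F y‖ ≤ L * ‖x - y‖) (x y : V) :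
    F y ≤ F x + inner ℝ (gradient F x) (y - x) + L * ‖y - x‖ ^ 2 := by
  have hx : x ∈ Metric.closedBall x ‖y - x‖ := by simp
  have hy : y ∈ Metric.closedBall x ‖y - x‖ := by simp [dist_eq_norm]
  have h := (convex_closedBall x ‖y - x‖).norm_image_sub_le_of_norm_hasFDerivWithin_le'
    (f := F) (f' := fderiv ℝ F) (φ := fderiv ℝ F x) (C := L * ‖y - x‖)
    (fun z _ => (hF z).hasFDerivAt.hasFDerivWithinAt) (fun z hz => ?_) hx hy
  · rw [Real.norm_eq_abs] at h
    have h' := (abs_le.1 h).2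
    rw [← inner_gradient_left] at h'
    nlinarith
  · have h1 := hlip z x
    rw [gradient, gradient, ← map_sub, LinearIsometryEquiv.norm_map] at h1
    refine h1.trans ?_
    gcongr
    simpa [dist_eq_norm] using hz

lemma hasGradientAt_avg {n : ℕ} {f : Fin n → V → ℝ} (hf : ∀ i, Differentiable ℝ (f i)) (x : V) :
    HasGradientAt (fun x => (1 / (n : ℝ)) * ∑ i, f i x) ((n : ℝ)⁻¹ • ∑ i, gradient (f i) x) x := by
  have h := HasFDerivAt.const_mul
    (HasFDerivAt.fun_sum (u := univ) fun i _ => ((hf i x).hasGradientAt).hasFDerivAt) (1 / (n : ℝ))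
  rw [hasGradientAt_iff_hasFDerivAt]
  refine h.congr_fderiv ?_
  rw [map_smulₛₗ, map_sum, one_div]
  simp

end Smoothness

section Epoch

variable {V : Type*} [NormedAddCommGroup V]

lemma epoch_iterate_sub_eq [NormedSpace ℝ V] {n : ℕ} {η β : ℝ} {w g : ℕ → V} {μ : V}
    (hw : ∀ i < n, w (i + 1) = w i - (η / n) • (β • μ + (1 - β) • g i)) (i : ℕ) (hi : i ≤ n) :
    w i - w 0 = -((η / n) • (β • ((i : ℝ) • μ) + (1 - β) • ∑ j ∈ range i, g j)) := by
  induction i with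
  | zero => simp
  | succ i ih =>
    rw [hw i (by omega), sum_range_succ, sub_right_comm, ih (by omega)]
    push_cast
    module

/-- The mean squared distance of the inner iterates of an epoch from its starting point. -/
lemma epoch_deviation_le [NormedSpace ℝ V] {n : ℕ} (hn : 1 ≤ n) {η β L : ℝ} (hβ0 : 0 ≤ β)
    (hβ1 : β ≤ 1) {w g h : ℕ → V} {μ : V} (G : V)
    (hw : ∀ i < n, w (i + 1) = w i - (η / n) • (β • μ + (1 - β) • g i))
    (hgh : ∀ i < n, ‖g i - h i‖ ≤ L * ‖w i - w 0‖) :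
    L ^ 2 / n * ∑ i ∈ range n, ‖w i - w 0‖ ^ 2 ≤
      L ^ 2 * η ^ 2 * (β * ‖μ‖ ^ 2 + 3 * (1 - β) *
        (L ^ 2 / n * ∑ i ∈ range n, ‖w i - w 0‖ ^ 2 + ‖G‖ ^ 2
          + 1 / (n : ℝ) ^ 3 * ∑ i ∈ range n, ‖∑ j ∈ range i, (h j - G)‖ ^ 2)) := by
  have hn' : (0 : ℝ) < n := by exact_mod_cast hn
  have hβ1' : 0 ≤ 1 - β := by linarith
  set S := ∑ i ∈ range n, ‖w i - w 0‖ ^ 2 with hS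
  have hS0 : 0 ≤ S := sum_nonneg fun i _ => by positivity
  have hsum : ∀ i < n, ‖∑ j ∈ range i, g j‖ ^ 2 ≤
      3 * (n * (L ^ 2 * S) + ‖∑ j ∈ range i, (h j - G)‖ ^ 2 + (n : ℝ) ^ 2 * ‖G‖ ^ 2) := by
    intro i hi
    have hi' : (i : ℝ) ≤ n := by exact_mod_cast hi.le
    have hdecomp : ∑ j ∈ range i, g j =
        ∑ j ∈ range i, (g j - h j) + ∑ j ∈ range i, (h j - G) + (i : ℝ) • G := by
      simp only [sum_sub_distrib, sum_const, card_range, Nat.cast_smul_eq_nsmul]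
      abel
    have h1 : ‖∑ j ∈ range i, (g j - h j)‖ ^ 2 ≤ n * (L ^ 2 * S) := by
      refine (norm_sum_sq_le _ _).trans ?_
      rw [card_range]
      gcongr
      calc ∑ j ∈ range i, ‖g j - h j‖ ^ 2 ≤ ∑ j ∈ range i, L ^ 2 * ‖w j - w 0‖ ^ 2 := by
            refine sum_le_sum fun j hj => ?_
            rw [← mul_pow]
            exact pow_le_pow_left₀ (norm_nonneg _) (hgh j ((mem_range.1 hj).trans hi)) 2
        _ ≤ ∑ j ∈ range n, L ^ 2 * ‖w j - w 0‖ ^ 2 :=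
            sum_le_sum_of_subset_of_nonneg (range_subset_range.2 hi.le) fun _ _ _ => by positivity
        _ = L ^ 2 * S := by rw [hS, mul_sum]
    have h2 : ‖(i : ℝ) • G‖ ^ 2 ≤ (n : ℝ) ^ 2 * ‖G‖ ^ 2 := by
      rw [norm_smul, mul_pow, RCLike.norm_natCast]
      gcongr
    rw [hdecomp]
    refine (norm_add_sq_le_three _ _ _).trans ?_
    gcongr
  have hterm : ∀ i ∈ range n, ‖w i - w 0‖ ^ 2 ≤ (η / n) ^ 2 * (β * ((n : ℝ) ^ 2 * ‖μ‖ ^ 2)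
      + (1 - β) * (3 * (n * (L ^ 2 * S) + ‖∑ j ∈ range i, (h j - G)‖ ^ 2
        + (n : ℝ) ^ 2 * ‖G‖ ^ 2))) := by
    intro i hi
    have hi := mem_range.1 hi
    have hi' : (i : ℝ) ≤ n := by exact_mod_cast hi.le
    rw [epoch_iterate_sub_eq hw i hi.le, norm_neg, norm_smul, mul_pow, Real.norm_eq_abs, sq_abs]
    gcongr
    refine (norm_convex_comb_sq_le_s11 hβ0 hβ1 _ _).trans ?_
    gcongr
    · rw [norm_smul, mul_pow, RCLike.norm_natCast]
      gcongr
    · exact hsum i hi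
  have htotal := sum_le_sum hterm
  rw [← hS] at htotal
  simp only [← mul_sum, sum_add_distrib, sum_const, card_range, nsmul_eq_mul] at htotal
  calc L ^ 2 / n * S ≤ L ^ 2 / n * _ := mul_le_mul_of_nonneg_left htotal (by positivity)
    _ = _ := by field_simp; ring

end Epoch

section Telescope

/-- Telescoping of the per-epoch descent inequalities of shuffling momentum: `Φ` are the objective
values, `A` the squared gradients, `P` the inner deviations, `N` the squared steps, `U` the squared
momenta, `B` the squared momentum errors and `E` the shuffling errors. -/
lemma sum_le_of_momentum_descent {T : ℕ} {β L : ℝ} (hβ0 : 0 ≤ β) (hβ1 : β < 1) (hL : 0 < L)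
    {η Φ A P N U B E : ℕ → ℝ} (hη : ∀ s ≤ T, 0 < η s) (hηdec : ∀ s < T, η (s + 1) ≤ η s)
    (hηL : ∀ s < T, L ^ 2 * η (s + 1) ^ 2 * (6 * (5 - 3 * β)) ≤ 1 - β)
    (hA : ∀ s < T, 0 ≤ A s) (hP : ∀ s < T, 0 ≤ P s) (hN : ∀ s < T, 0 ≤ N s)
    (hU : ∀ s ≤ T, 0 ≤ U s) (hB : ∀ s ≤ T, 0 ≤ B s) (hE : ∀ s < T, 0 ≤ E s)
    (hU0 : U 0 = 0) (hB0 : B 0 = 0)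
    (hUs : ∀ s < T, U (s + 1) ≤ 2 * A s + 2 * P s)
    (hBs : ∀ s < T, B (s + 1) ≤ 2 * P s + 2 * (L ^ 2 * η (s + 1) ^ 2) * N s)
    (hPs : ∀ s < T, P s ≤ L ^ 2 * η (s + 1) ^ 2 * (β * U s + 3 * (1 - β) * (P s + A s + E s)))
    (hΦ : ∀ s < T, Φ (s + 1) ≤ Φ s - (1 - β) * (η (s + 1) / 2) * A s
      + η (s + 1) / 2 * (β * B s + (1 - β) * P s) - η (s + 1) / 2 * (1 - 2 * L * η (s + 1)) * N s) :
    ∑ s ∈ range T, η (s + 1) * ((1 - β) * ((1 / 2 - β / 5) * A s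
      - 10 / 3 * (L ^ 2 * η (s + 1) ^ 2) * (A s + E s))) ≤ Φ 0 - Φ T := by
  suffices key : ∀ k ≤ T, Φ k + η k * (β / 2 * B k + β * (1 - β) / 10 * U k)
      + ∑ s ∈ range k, η (s + 1) * ((1 - β) * ((1 / 2 - β / 5) * A s
        - 10 / 3 * (L ^ 2 * η (s + 1) ^ 2) * (A s + E s))) ≤ Φ 0 by
    have h1 := key T le_rfl
    have h2 : 0 ≤ η T * (β / 2 * B T + β * (1 - β) / 10 * U T) := by
      have := hη T le_rfl
      have := hB T le_rfl
      have := hU T le_rfl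
      have : 0 ≤ 1 - β := by linarith
      positivity
    linarith
  intro k
  induction k with
  | zero => simp [hU0, hB0]
  | succ k ih =>
    intro hk
    have ih := ih (by omega)
    have hkT : k < T := by omega
    rw [sum_range_succ]
    have hdesc := hΦ k hkT
    have hx := hη (k + 1) hk
    have hdec := hηdec k hkT
    have hsmall := hηL k hkT
    have hA := hA k hkT
    have hP := hP k hkT
    have hN := hN k hkT
    have hU := hU k hkT.le
    have hB := hB k hkT.le
    have hE := hE k hkT
    have hUs := hUs k hkT
    have hBs := hBs k hkT
    have hPs := hPs k hkT
    generalize η (k + 1) = x at *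
    have hγ : 0 < 1 - β := by linarith
    have hLx0 : 0 < L * x := by positivity
    have ha0 : 0 ≤ L ^ 2 * x ^ 2 := by positivity
    have ha : L ^ 2 * x ^ 2 ≤ 1 / 30 := by
      nlinarith only [hsmall, ha0, hβ0, hβ1]
    have haγ : L ^ 2 * x ^ 2 ≤ (1 - β) / 12 := by
      nlinarith only [hsmall, ha0, hβ0, hβ1]
    have hLx : L * x ≤ 1 / 5 := by nlinarith only [ha, hLx0]
    generalize L ^ 2 * x ^ 2 = a at *
    have hPbound : P k ≤ 10 / 9 * a * β * U k + 10 / 3 * (1 - β) * a * (A k + E k) := by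
      have : 3 * (1 - β) * a * P k ≤ 1 / 10 * P k :=
        mul_le_mul_of_nonneg_right (by nlinarith only [ha, ha0, hβ0, hγ]) hP
      linarith
    have hcoefU : 10 / 9 * a * β * U k ≤ β * (1 - β) / 10 * U k :=
      mul_le_mul_of_nonneg_right
        (by linarith [mul_le_mul_of_nonneg_left haγ hβ0, mul_nonneg hβ0 hγ.le]) hU
    have hcoefP : ((1 + β) / 2 + β * (1 - β) / 5) * P k ≤ P k := by
      have : ((1 + β) / 2 + β * (1 - β) / 5) ≤ 1 := by
        nlinarith only [mul_nonneg hβ0 hγ.le, hγ, hβ0, sq_nonneg (1 - β)]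
      nlinarith only [this, hP]
    have hcoefN : β * a * N k ≤ (1 / 2 - L * x) * N k :=
      mul_le_mul_of_nonneg_right (by nlinarith only [ha, ha0, hβ0, hβ1, hLx]) hN
    have hold : x * (β / 2 * B k + β * (1 - β) / 10 * U k)
        ≤ η k * (β / 2 * B k + β * (1 - β) / 10 * U k) :=
      mul_le_mul_of_nonneg_right hdec (by positivity)
    have hstep : β / 2 * B (k + 1) + β * (1 - β) / 10 * U (k + 1) + (1 - β) / 2 * P k
        + (1 - β) * ((1 / 2 - β / 5) * A k - 10 / 3 * a * (A k + E k)) - (1 - β) / 2 * A k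
        - (1 / 2 - L * x) * N k ≤ β * (1 - β) / 10 * U k := by
      have e1 := mul_le_mul_of_nonneg_left hBs (by positivity : 0 ≤ β / 2)
      have e2 := mul_le_mul_of_nonneg_left hUs (by positivity : 0 ≤ β * (1 - β) / 10)
      linarith
    have := mul_le_mul_of_nonneg_left hstep hx.le
    linarith

end Telescope

section Path

variable {V : Type*} [NormedAddCommGroup V] [InnerProductSpace ℝ V] [CompleteSpace V]

lemma momentum_step_descent {F : V → ℝ} (hF : Differentiable ℝ F) {L : ℝ} (hL : 0 ≤ L)
    (hlip : ∀ x y, ‖gradient F x - gradient F y‖ ≤ L * ‖x - y‖) {η β : ℝ} (hη : 0 ≤ η)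
    (hβ0 : 0 ≤ β) (hβ1 : β ≤ 1) (x μ ν : V) :
    F (x - η • (β • μ + (1 - β) • ν)) ≤ F x - η / 2 * ‖gradient F x‖ ^ 2
      + η / 2 * (β * ‖gradient F x - μ‖ ^ 2 + (1 - β) * ‖gradient F x - ν‖ ^ 2)
      - η / 2 * (1 - 2 * L * η) * ‖β • μ + (1 - β) • ν‖ ^ 2 := by
  set G := gradient F x with hG
  have hconv := norm_convex_comb_sq_le_s11 hβ0 hβ1 (G - μ) (G - ν)
  rw [show β • (G - μ) + (1 - β) • (G - ν) = G - (β • μ + (1 - β) • ν) by module] at hconv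
  set M := β • μ + (1 - β) • ν with hM
  have h := le_add_inner_gradient_add hF hL hlip x (x - η • M)
  rw [show x - η • M - x = -(η • M) by abel, inner_neg_right, inner_smul_right, norm_neg,
    norm_smul, mul_pow, Real.norm_eq_abs, sq_abs, ← hG] at h
  have hsq := norm_sub_sq_real G M
  have := mul_le_mul_of_nonneg_left hconv (by positivity : 0 ≤ η / 2)
  rw [hsq] at this
  linarith

/-- The pathwise estimate for the shuffling momentum method: `q s i` is the component gradient
used in step `i` of epoch `s`, `x s` and `μ s` are the iterate and the momentum before epoch `s`. -/
lemma shuffling_momentum_path_bound {n T : ℕ} (hn : 1 ≤ n) {F : V → ℝ} (hF : Differentiable ℝ F)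
    {β L : ℝ} (hβ0 : 0 ≤ β) (hβ1 : β < 1) (hL : 0 < L)
    {q : ℕ → ℕ → V → V} (hqL : ∀ s i x y, ‖q s i x - q s i y‖ ≤ L * ‖x - y‖)
    (hq : ∀ s < T, ∀ x, gradient F x = (n : ℝ)⁻¹ • ∑ i ∈ range n, q s i x)
    (hlip : ∀ x y, ‖gradient F x - gradient F y‖ ≤ L * ‖x - y‖)
    {η : ℕ → ℝ} (hη : ∀ s ≤ T, 0 < η s) (hηdec : ∀ s < T, η (s + 1) ≤ η s)
    (hηL : ∀ s < T, L ^ 2 * η (s + 1) ^ 2 * (6 * (5 - 3 * β)) ≤ 1 - β)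
    {x μ : ℕ → V} {w : ℕ → ℕ → V} (hμ0 : μ 0 = 0)
    (hw0 : ∀ s < T, w s 0 = x s)
    (hw : ∀ s < T, ∀ i < n,
      w s (i + 1) = w s i - (η (s + 1) / n) • (β • μ s + (1 - β) • q s i (w s i)))
    (hx : ∀ s < T, x (s + 1) = w s n)
    (hμ : ∀ s < T, μ (s + 1) = (n : ℝ)⁻¹ • ∑ i ∈ range n, q s i (w s i)) :
    ∑ s ∈ range T, η (s + 1) * ((1 - β) * ((1 / 2 - β / 5) * ‖gradient F (x s)‖ ^ 2
      - 10 / 3 * (L ^ 2 * η (s + 1) ^ 2) * (‖gradient F (x s)‖ ^ 2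
        + 1 / (n : ℝ) ^ 3 * ∑ i ∈ range n, ‖∑ j ∈ range i, (q s j (x s) - gradient F (x s))‖ ^ 2)))
      ≤ F (x 0) - F (x T) := by
  have hn' : (0 : ℝ) < n := by exact_mod_cast hn
  have hxs : ∀ s < T, x (s + 1) = x s - η (s + 1) • (β • μ s + (1 - β) • μ (s + 1)) := by
    intro s hs
    have h := epoch_iterate_sub_eq (hw s hs) n le_rfl
    rw [hw0 s hs, ← hx s hs, sub_eq_iff_eq_add] at h
    rw [h, hμ s hs]
    match_scalars <;> field_simp
  have hforward : ∀ s < T, ‖gradient F (x s) - μ (s + 1)‖ ^ 2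
      ≤ L ^ 2 / n * ∑ i ∈ range n, ‖w s i - w s 0‖ ^ 2 := by
    intro s hs
    rw [hμ s hs, hq s hs]
    refine norm_avg_sub_avg_sq_le hn _ _ _ L fun i _ => ?_
    rw [hw0 s hs, norm_sub_rev (w s i)]
    exact hqL s i _ _
  refine sum_le_of_momentum_descent (Φ := fun s => F (x s))
    (P := fun s => L ^ 2 / n * ∑ i ∈ range n, ‖w s i - w s 0‖ ^ 2)
    (N := fun s => ‖β • μ s + (1 - β) • μ (s + 1)‖ ^ 2) (U := fun s => ‖μ s‖ ^ 2)
    (B := fun s => if s = 0 then 0 else ‖gradient F (x s) - μ s‖ ^ 2)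
    hβ0 hβ1 hL hη hηdec hηL (fun s _ => by positivity) (fun s _ => by positivity)
    (fun s _ => by positivity) (fun s _ => by positivity)
    (fun s _ => by split_ifs <;> positivity)
    (fun s _ => by positivity) (by simp [hμ0]) (by simp) ?_ ?_ ?_ ?_
  · intro s hs
    have h := norm_add_sq_le_two (gradient F (x s)) (μ (s + 1) - gradient F (x s))
    rw [add_sub_cancel, norm_sub_rev (μ (s + 1))] at h
    have := hforward s hs
    linarith
  · intro s hs
    simp only [Nat.add_eq_zero_iff, one_ne_zero, and_false, if_false]
    have hbackward : ‖gradient F (x (s + 1)) - μ (s + 1)‖ ^ 2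
        ≤ L ^ 2 / n * ∑ i ∈ range n, ‖x (s + 1) - w s i‖ ^ 2 := by
      rw [hμ s hs, hq s hs]
      exact norm_avg_sub_avg_sq_le hn _ _ _ L fun i _ => hqL s i _ _
    refine hbackward.trans ?_
    have hterm : ∀ i ∈ range n, ‖x (s + 1) - w s i‖ ^ 2 ≤
        2 * ‖w s i - w s 0‖ ^ 2
          + 2 * (η (s + 1) ^ 2 * ‖β • μ s + (1 - β) • μ (s + 1)‖ ^ 2) := by
      intro i _
      have h := norm_add_sq_le_two (w s 0 - w s i) (x (s + 1) - w s 0)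
      rw [add_comm, sub_add_sub_cancel, norm_sub_rev (w s 0)] at h
      refine h.trans_eq ?_
      rw [hw0 s hs, hxs s hs, sub_sub_cancel_left, norm_neg, norm_smul, mul_pow,
        Real.norm_eq_abs, sq_abs]
    calc _ ≤ L ^ 2 / n * _ := mul_le_mul_of_nonneg_left (sum_le_sum hterm) (by positivity)
      _ = _ := by
        rw [sum_add_distrib, ← mul_sum, sum_const, card_range, nsmul_eq_mul]
        field_simp
  · intro s hs
    have h := epoch_deviation_le hn (h := fun i => q s i (x s)) hβ0 hβ1.le (gradient F (x s))
      (hw s hs) (fun i _ => by rw [hw0 s hs]; exact hqL s i _ _)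
    exact h
  · intro s hs
    have hη' := hη (s + 1) hs
    have h := momentum_step_descent hF hL.le hlip hη'.le hβ0 hβ1.le (x s) (μ s) (μ (s + 1))
    rw [← hxs s hs] at h
    have hf := mul_le_mul_of_nonneg_left (hforward s hs)
      (mul_nonneg (by positivity : 0 ≤ η (s + 1) / 2) (by linarith : 0 ≤ 1 - β))
    have hA : 0 ≤ η (s + 1) / 2 * (β * ‖gradient F (x s)‖ ^ 2) := by positivity
    split_ifs with h0
    · subst h0
      rw [hμ0, sub_zero] at h
      rw [hμ0]
      linarith
    · linarith

end Path

theorem smg_rr_theorem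
    (n d : ℕ) (hn : 1 ≤ n) (hd : 1 ≤ d)
    (f : Fin n → EuclideanSpace ℝ (Fin d) → ℝ)
    (hf : ∀ i, Differentiable ℝ (f i))
    (F : EuclideanSpace ℝ (Fin d) → ℝ)
    (hF : F = fun x => (1 / (n : ℝ)) * ∑ i, f i x)
    (L : ℝ) (hL : 0 < L)
    (hsmooth : ∀ i x y, ‖gradient (f i) x - gradient (f i) y‖ ≤ L * ‖x - y‖)
    (Θ σ : ℝ) (hΘ : 0 ≤ Θ) (hσ : 0 ≤ σ)
    (hvar : ∀ x, (1 / (n : ℝ)) * ∑ i, ‖gradient (f i) x - gradient F x‖ ^ 2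
        ≤ Θ * ‖gradient F x‖ ^ 2 + σ ^ 2)
    (Fstar : ℝ) (hFstar : IsGLB (Set.range F) Fstar)
    (T : ℕ) (hT : 1 ≤ T)
    (β : ℝ) (hβ0 : 0 ≤ β) (hβ1 : β < 1)
    (η : ℕ → ℝ) (hηpos : ∀ t, 1 ≤ t → t ≤ T → 0 < η t)
    (w0 : EuclideanSpace ℝ (Fin d))
    (w m v g : (Fin T → Equiv.Perm (Fin n)) → ℕ → ℕ → EuclideanSpace ℝ (Fin d))
    (wt mt : (Fin T → Equiv.Perm (Fin n)) → ℕ → EuclideanSpace ℝ (Fin d))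
    (hwt0 : ∀ ω, wt ω 0 = w0)
    (hmt0 : ∀ ω, mt ω 0 = 0)
    (hw0 : ∀ ω t, 1 ≤ t → t ≤ T → w ω t 0 = wt ω (t - 1))
    (hm0 : ∀ ω t, 1 ≤ t → t ≤ T → m ω t 0 = mt ω (t - 1))
    (hv0 : ∀ ω t, 1 ≤ t → t ≤ T → v ω t 0 = 0)
    (hg : ∀ ω t, ∀ ht1 : 1 ≤ t, ∀ ht2 : t ≤ T, ∀ i, ∀ hi : i < n,
        g ω t i = gradient (f (ω ⟨t - 1, by omega⟩ ⟨i, hi⟩)) (w ω t i))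
    (hm1 : ∀ ω t, 1 ≤ t → t ≤ T → ∀ i, i < n →
        m ω t (i + 1) = β • m ω t 0 + (1 - β) • g ω t i)
    (hv1 : ∀ ω t, 1 ≤ t → t ≤ T → ∀ i, i < n →
        v ω t (i + 1) = v ω t i + ((n : ℝ))⁻¹ • g ω t i)
    (hw1 : ∀ ω t, 1 ≤ t → t ≤ T → ∀ i, i < n →
        w ω t (i + 1) = w ω t i - (η t / (n : ℝ)) • m ω t (i + 1))
    (hwtn : ∀ ω t, 1 ≤ t → t ≤ T → wt ω t = w ω t n)
    (hmtn : ∀ ω t, 1 ≤ t → t ≤ T → mt ω t = v ω t n)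
    (D : ℝ)
    (hDdef : D = max (5 / 3) (6 * (5 - 3 * β) * (Θ + (n : ℝ)) / ((n : ℝ) * (1 - β))))
    (hη0 : η 0 = η 1)
    (hηdec : ∀ t, 1 ≤ t → t ≤ T - 1 → η (t + 1) ≤ η t)
    (hηD : ∀ t, 1 ≤ t → t ≤ T → η t ≤ 1 / (L * Real.sqrt D)) :
    (∑ t ∈ Icc 1 T, η t *
        ((Fintype.card (Fin T → Equiv.Perm (Fin n)) : ℝ)⁻¹ *
          ∑ ω : Fin T → Equiv.Perm (Fin n), ‖gradient F (wt ω (t - 1))‖ ^ 2))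
      / (∑ t ∈ Icc 1 T, η t)
      ≤ 4 * (F w0 - Fstar) / ((1 - β) * ∑ t ∈ Icc 1 T, η t)
        + 6 * σ ^ 2 * (5 - 3 * β) * L ^ 2 / ((n : ℝ) * (1 - β))
          * ((∑ t ∈ Icc 1 T, η (t - 1) ^ 3) / (∑ t ∈ Icc 1 T, η t)) := by
  have hn' : (0 : ℝ) < n := by exact_mod_cast hn
  have : NeZero n := ⟨by omega⟩
  have : NeZero T := ⟨by omega⟩
  have hγ : 0 < 1 - β := by linarith
  have hgradF : ∀ x, HasGradientAt F ((n : ℝ)⁻¹ • ∑ i, gradient (f i) x) x := by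
    intro x
    rw [hF]
    exact hasGradientAt_avg hf x
  have hFdiff : Differentiable ℝ F := fun x => (hgradF x).differentiableAt
  have hofNat : ∀ i (hi : i < n), Fin.ofNat n i = ⟨i, hi⟩ := fun i hi =>
    Fin.ext (Nat.mod_eq_of_lt hi)
  have hofNatT : ∀ s (hs : s < T), Fin.ofNat T s = ⟨s, hs⟩ := fun s hs =>
    Fin.ext (Nat.mod_eq_of_lt hs)
  have hgrad_perm : ∀ (π : Equiv.Perm (Fin n)) x,
      gradient F x = (n : ℝ)⁻¹ • ∑ i ∈ range n, gradient (f (π (Fin.ofNat n i))) x := by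
    intro π x
    rw [(hgradF x).gradient, ← Equiv.sum_comp π, Finset.sum_range]
    simp
  have hlip : ∀ x y, ‖gradient F x - gradient F y‖ ≤ L * ‖x - y‖ := by
    intro x y
    rw [(hgradF x).gradient, (hgradF y).gradient, ← smul_sub, ← sum_sub_distrib, norm_smul,
      norm_inv, RCLike.norm_natCast, inv_mul_le_iff₀ hn']
    refine (norm_sum_le _ _).trans ((sum_le_sum fun i _ => hsmooth i x y).trans_eq ?_)
    simp
  have hηnonneg : ∀ s ≤ T, 0 < η s := by
    intro s hs
    rcases Nat.eq_zero_or_pos s with rfl | h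
    · rw [hη0]; exact hηpos 1 le_rfl hT
    · exact hηpos s h hs
  have hηanti : ∀ s < T, η (s + 1) ≤ η s := by
    intro s hs
    rcases Nat.eq_zero_or_pos s with rfl | h
    · exact hη0.ge
    · exact hηdec s h (by omega)
  have hηsmall : ∀ s < T,
      L ^ 2 * η (s + 1) ^ 2 * (1 + Θ / n) * (6 * (5 - 3 * β)) ≤ 1 - β := by
    intro s hs
    have hpos := hηnonneg (s + 1) hs
    have hDpos : 0 < D := by rw [hDdef]; exact lt_max_of_lt_left (by norm_num)
    have hDge : 6 * (5 - 3 * β) * (Θ + n) / (n * (1 - β)) ≤ D := hDdef ▸ le_max_right _ _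
    have h1 := hηD (s + 1) (by omega) hs
    rw [le_div_iff₀ (by positivity)] at h1
    have h2 := pow_le_pow_left₀ (by positivity) h1 2
    rw [one_pow, mul_pow, mul_pow, Real.sq_sqrt hDpos.le] at h2
    rw [div_le_iff₀ (by positivity)] at hDge
    have h3 : L ^ 2 * η (s + 1) ^ 2 * (6 * (5 - 3 * β) * (Θ + n)) ≤ n * (1 - β) := by
      calc _ ≤ L ^ 2 * η (s + 1) ^ 2 * (D * (n * (1 - β))) := by gcongr
        _ = (η (s + 1) ^ 2 * (L ^ 2 * D)) * (n * (1 - β)) := by ring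
        _ ≤ 1 * (n * (1 - β)) := by gcongr
        _ = _ := one_mul _
    refine le_of_mul_le_mul_left ?_ hn'
    refine le_trans (le_of_eq ?_) h3
    field_simp
    ring
  have hηsmall' : ∀ s < T, L ^ 2 * η (s + 1) ^ 2 * (6 * (5 - 3 * β)) ≤ 1 - β := by
    intro s hs
    refine le_trans ?_ (hηsmall s hs)
    have h0 : 0 ≤ 6 * (5 - 3 * β) := by linarith
    have h1 : 1 ≤ 1 + Θ / n := le_add_of_nonneg_right (by positivity)
    exact mul_le_mul_of_nonneg_right (le_mul_of_one_le_right (by positivity) h1) h0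
  set q : (Fin T → Equiv.Perm (Fin n)) → ℕ → ℕ → EuclideanSpace ℝ (Fin d) →
      EuclideanSpace ℝ (Fin d) :=
    fun ω s i => gradient (f (ω (Fin.ofNat T s) (Fin.ofNat n i))) with hqdef
  have hgq : ∀ ω, ∀ s < T, ∀ i < n, g ω (s + 1) i = q ω s i (w ω (s + 1) i) := by
    intro ω s hs i hi
    simp only [hqdef]
    rw [hg ω (s + 1) (by omega) hs i hi, hofNat i hi, hofNatT s hs]
    rfl
  have hwstep : ∀ ω, ∀ s < T, ∀ i < n, w ω (s + 1) (i + 1) = w ω (s + 1) i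
      - (η (s + 1) / n) • (β • mt ω s + (1 - β) • q ω s i (w ω (s + 1) i)) := by
    intro ω s hs i hi
    rw [hw1 ω (s + 1) (by omega) hs i hi, hm1 ω (s + 1) (by omega) hs i hi,
      hm0 ω (s + 1) (by omega) hs, hgq ω s hs i hi, Nat.add_sub_cancel]
  have hmstep : ∀ ω, ∀ s < T,
      mt ω (s + 1) = (n : ℝ)⁻¹ • ∑ i ∈ range n, q ω s i (w ω (s + 1) i) := by
    intro ω s hs
    have hvsum : ∀ i ≤ n, v ω (s + 1) i = (n : ℝ)⁻¹ • ∑ j ∈ range i, q ω s j (w ω (s + 1) j) := by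
      intro i
      induction i with
      | zero => intro _; simp [hv0 ω (s + 1) (by omega) hs]
      | succ i ih =>
        intro hi
        rw [hv1 ω (s + 1) (by omega) hs i hi, ih (by omega), sum_range_succ, smul_add,
          hgq ω s hs i hi]
    rw [hmtn ω (s + 1) (by omega) hs, hvsum n le_rfl]
  have hadapted : ∀ s ≤ T, ∀ ω ω', (∀ k : Fin T, (k : ℕ) < s → ω k = ω' k) →
      wt ω s = wt ω' s ∧ mt ω s = mt ω' s := by
    intro s
    induction s with
    | zero => intro _ ω ω' _; simp [hwt0, hmt0]
    | succ s ih =>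
      intro hs ω ω' hωω'
      obtain ⟨ihw, ihm⟩ := ih (by omega) ω ω' fun k hk => hωω' k (by omega)
      have hq : q ω s = q ω' s := by
        simp only [hqdef]
        rw [hωω' (Fin.ofNat T s) (by rw [hofNatT s hs]; exact Nat.lt_succ_self s)]
      have hinner : ∀ i ≤ n, w ω (s + 1) i = w ω' (s + 1) i := by
        intro i
        induction i with
        | zero =>
          intro _
          rw [hw0 ω (s + 1) (by omega) hs, hw0 ω' (s + 1) (by omega) hs, Nat.add_sub_cancel, ihw]
        | succ i ihi =>
          intro hi
          rw [hwstep ω s hs i hi, hwstep ω' s hs i hi, ihi (by omega), ihm, hq]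
      refine ⟨?_, ?_⟩
      · rw [hwtn ω (s + 1) (by omega) hs, hwtn ω' (s + 1) (by omega) hs, hinner n le_rfl]
      · rw [hmstep ω s hs, hmstep ω' s hs, hq]
        congr 1
        exact sum_congr rfl fun i hi => by rw [hinner i (mem_range.1 hi).le]
  set A : (Fin T → Equiv.Perm (Fin n)) → ℕ → ℝ :=
    fun ω s => ‖gradient F (wt ω s)‖ ^ 2 with hAdef
  set E : (Fin T → Equiv.Perm (Fin n)) → ℕ → ℝ := fun ω s => 1 / (n : ℝ) ^ 3 *
    ∑ i ∈ range n, ‖∑ j ∈ range i, (q ω s j (wt ω s) - gradient F (wt ω s))‖ ^ 2 with hEdef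
  have hpath : ∀ ω, ∑ s ∈ range T, η (s + 1) * ((1 - β) * ((1 / 2 - β / 5) * A ω s
      - 10 / 3 * (L ^ 2 * η (s + 1) ^ 2) * (A ω s + E ω s))) ≤ F w0 - Fstar := by
    intro ω
    have h := shuffling_momentum_path_bound hn hFdiff hβ0 hβ1 hL (q := q ω)
      (fun s i x y => hsmooth _ x y) (fun s hs x => hgrad_perm (ω (Fin.ofNat T s)) x)
      hlip hηnonneg hηanti hηsmall' (x := wt ω) (μ := mt ω) (w := fun s => w ω (s + 1)) (hmt0 ω)
      (fun s hs => hw0 ω (s + 1) (by omega) hs) (hwstep ω)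
      (fun s hs => hwtn ω (s + 1) (by omega) hs) (hmstep ω)
    have hbelow : Fstar ≤ F (wt ω T) := hFstar.1 ⟨_, rfl⟩
    rw [hwt0 ω] at h
    exact h.trans (by linarith)
  have hvariance : ∀ s < T, ∑ ω, E ω s ≤ ∑ ω, (Θ * A ω s + σ ^ 2) / n := by
    intro s hs
    have hpartial : ∀ i ∈ range n,
        ∑ ω, ‖∑ j ∈ range i, (q ω s j (wt ω s) - gradient F (wt ω s))‖ ^ 2
          ≤ ∑ ω, n * (Θ * A ω s + σ ^ 2) := by
      intro i hi
      have hin := mem_range.1 hi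
      have hinj : Set.InjOn (Fin.ofNat n) (range i : Finset ℕ) := by
        intro a ha b hb hab
        have ha' : a < n := (mem_range.1 ha).trans hin
        have hb' : b < n := (mem_range.1 hb).trans hin
        rw [hofNat a ha', hofNat b hb'] at hab
        exact congrArg Fin.val hab
      have h := sum_pi_perm_norm_sum_sq_le (Fin.ofNat T s)
        (fun ω l => gradient (f l) (wt ω s) - gradient F (wt ω s)) (fun ω => ?_) (fun ω τ => ?_)
        ((range i).image (Fin.ofNat n))
      · simp only [sum_image hinj] at h
        refine h.trans (sum_le_sum fun ω _ => ?_)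
        have hv := hvar (wt ω s)
        rw [one_div, inv_mul_le_iff₀ hn'] at hv
        exact hv
      · rw [sum_sub_distrib, sum_const, card_univ, Fintype.card_fin, (hgradF _).gradient,
          ← Nat.cast_smul_eq_nsmul ℝ, smul_inv_smul₀ hn'.ne', sub_self]
      · have hw' := (hadapted s hs.le (ω * Pi.mulSingle (Fin.ofNat T s) τ) ω fun k hk => ?_).1
        · simp only [hw']
        · have hne : k ≠ Fin.ofNat T s := by
            rintro rfl
            rw [hofNatT s hs] at hk
            exact lt_irrefl _ hk
          rw [Pi.mul_apply, Pi.mulSingle_eq_of_ne hne, mul_one]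
    simp only [hEdef]
    rw [← mul_sum, sum_comm]
    calc _ ≤ 1 / (n : ℝ) ^ 3 * ∑ i ∈ range n, ∑ ω, n * (Θ * A ω s + σ ^ 2) :=
          mul_le_mul_of_nonneg_left (sum_le_sum hpartial) (by positivity)
      _ = _ := by
        rw [sum_const, card_range, nsmul_eq_mul, ← mul_sum, ← sum_div]
        field_simp
  set c : ℝ := (Fintype.card (Fin T → Equiv.Perm (Fin n)) : ℝ) with hcdef
  have hc : 0 < c := by
    rw [hcdef]
    exact_mod_cast Fintype.card_pos
  have hAnonneg : ∀ ω s, 0 ≤ A ω s := fun ω s => sq_nonneg _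
  clear_value A E c
  have hsumω : ∀ s < T, η (s + 1) * ((1 - β) * (1 / 4 * ∑ ω, A ω s))
      - c * (3 / 2 * (σ ^ 2 * (5 - 3 * β) * L ^ 2 / n) * η s ^ 3)
      ≤ ∑ ω, η (s + 1) * ((1 - β) * ((1 / 2 - β / 5) * A ω s
        - 10 / 3 * (L ^ 2 * η (s + 1) ^ 2) * (A ω s + E ω s))) := by
    intro s hs
    have hx := hηnonneg (s + 1) hs
    have hcube := pow_le_pow_left₀ hx.le (hηanti s hs) 3
    have hv := hvariance s hs
    have hsm := hηsmall s hs
    have hA0 : 0 ≤ ∑ ω, A ω s := sum_nonneg fun ω _ => hAnonneg ω s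
    rw [← sum_div, sum_add_distrib, ← mul_sum, sum_const, card_univ, nsmul_eq_mul, ← hcdef] at hv
    rw [← mul_sum, ← mul_sum, sum_sub_distrib, ← mul_sum, ← mul_sum, sum_add_distrib]
    generalize ∑ ω, A ω s = SA at *
    generalize ∑ ω, E ω s = SE at *
    have ha0 : 0 ≤ L ^ 2 * η (s + 1) ^ 2 := by positivity
    have hcoef : 10 / 3 * (L ^ 2 * η (s + 1) ^ 2 * (1 + Θ / n)) ≤ 1 / 4 - β / 5 := by
      by_contra! hlt
      have := mul_lt_mul_of_pos_right hlt (by linarith : 0 < 6 * (5 - 3 * β))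
      nlinarith only [this, hsm, sq_nonneg (β - 1), hβ0, hβ1]
    have hnoise : η (s + 1) * ((1 - β) * (10 / 3 * (L ^ 2 * η (s + 1) ^ 2) * (c * σ ^ 2 / n)))
        ≤ c * (3 / 2 * (σ ^ 2 * (5 - 3 * β) * L ^ 2 / n) * η s ^ 3) := by
      calc _ = c * (10 / 3 * (1 - β)) * (σ ^ 2 * L ^ 2 / n) * η (s + 1) ^ 3 := by ring
        _ ≤ c * (3 / 2 * (5 - 3 * β)) * (σ ^ 2 * L ^ 2 / n) * η s ^ 3 := by
          have h5 : 10 / 3 * (1 - β) ≤ 3 / 2 * (5 - 3 * β) := by linarith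
          have h5' : 0 ≤ 3 / 2 * (5 - 3 * β) := by linarith
          gcongr
        _ = _ := by ring
    have h1 : 10 / 3 * (L ^ 2 * η (s + 1) ^ 2) * (SA + SE) ≤ (1 / 4 - β / 5) * SA
        + 10 / 3 * (L ^ 2 * η (s + 1) ^ 2) * (c * σ ^ 2 / n) := by
      calc _ ≤ 10 / 3 * (L ^ 2 * η (s + 1) ^ 2) * (SA + (Θ * SA + c * σ ^ 2) / n) := by gcongr
        _ = 10 / 3 * (L ^ 2 * η (s + 1) ^ 2 * (1 + Θ / n)) * SA
            + 10 / 3 * (L ^ 2 * η (s + 1) ^ 2) * (c * σ ^ 2 / n) := by ring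
        _ ≤ _ := by gcongr
    have h2 := mul_le_mul_of_nonneg_left h1 (mul_nonneg hx.le hγ.le)
    linarith
  have htotal := sum_le_sum fun ω (_ : ω ∈ univ) => hpath ω
  rw [sum_comm, sum_const, card_univ, nsmul_eq_mul, ← hcdef] at htotal
  have hlower := (sum_le_sum fun s hs => hsumω s (mem_range.1 hs)).trans htotal
  rw [sum_sub_distrib, ← mul_sum, ← mul_sum] at hlower
  have hreindex : ∀ φ : ℕ → ℝ, ∑ t ∈ Icc 1 T, φ t = ∑ s ∈ range T, φ (s + 1) := by
    intro φ
    rw [range_eq_Ico, sum_Ico_add' φ 0 T 1, zero_add]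
    rfl
  rw [hreindex (fun t => η t * (c⁻¹ * ∑ ω, ‖gradient F (wt ω (t - 1))‖ ^ 2)), hreindex η,
    hreindex fun t => η (t - 1) ^ 3]
  simp only [Nat.add_sub_cancel]
  have hSpos : 0 < ∑ s ∈ range T, η (s + 1) :=
    sum_pos (fun s hs => hηnonneg (s + 1) (mem_range.1 hs)) ⟨0, mem_range.2 hT⟩
  have hmean : ∑ s ∈ range T, η (s + 1) * (c⁻¹ * ∑ ω, ‖gradient F (wt ω s)‖ ^ 2)
      ≤ 4 * (F w0 - Fstar) / (1 - β)
        + 6 * σ ^ 2 * (5 - 3 * β) * L ^ 2 / (n * (1 - β)) * ∑ s ∈ range T, η s ^ 3 := by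
    have hl : ∑ s ∈ range T, η (s + 1) * ((1 - β) * (1 / 4 * ∑ ω, A ω s))
        = c * ((1 - β) / 4) *
          ∑ s ∈ range T, η (s + 1) * (c⁻¹ * ∑ ω, ‖gradient F (wt ω s)‖ ^ 2) := by
      rw [mul_sum]
      refine sum_congr rfl fun s _ => ?_
      simp only [hAdef]
      field_simp
    rw [hl] at hlower
    refine le_of_mul_le_mul_left ?_ (by positivity : 0 < c * ((1 - β) / 4))
    refine (sub_le_iff_le_add.1 hlower).trans_eq ?_
    field_simp
    ring
  calc _ ≤ _ := div_le_div_of_nonneg_right hmean hSpos.le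
    _ = _ := by field_simp
end
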